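/- arXiv:math/0512419 — 2 statements merged into one kernel-verified Lean document; each statement's English description precedes it below -/
import Mathlib

section
/- The only rational solutions (X, Y) of the equation Y² = -X⁶ + 2X³ + 3 are (X, Y) = (-1, 0), (1, 2) and (1, -2). -/
namespace RationalPointsC3

open QuadraticAlgebra

/-- `ℤ[√3]`. -/
abbrev Zr := QuadraticAlgebra ℤ 3 0

/-- The field `ℚ(√3)`. -/
abbrev Fr := QuadraticAlgebra ℚ 3 0

/-- `√3` in `ℤ[√3]`. -/
abbrev sZ : Zr := ⟨0, 1⟩

/-- `√3` in `ℚ(√3)`. -/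
abbrev s : Fr := ⟨0, 1⟩

/-- The ring of integers `ℤ[ζ₁₂]`, as an extension of `ℤ[√3]`. -/
abbrev Oz := QuadraticAlgebra Zr (-1) sZ

/-- The cyclotomic field `ℚ(ζ₁₂)`, as an extension of `ℚ(√3)`. -/
abbrev Mz := QuadraticAlgebra Fr (-1) s

instance fact_three_not_sq : Fact (∀ r : ℚ, r ^ 2 ≠ 3 + 0 * r) := ⟨fun r h => by
  have h3 : IsSquare (3 : ℚ) := ⟨r, by linarith⟩
  have : ¬ IsSquare (3 : ℚ) := by
    rw [show (3 : ℚ) = ((3 : ℕ) : ℚ) by norm_num, Rat.isSquare_natCast_iff]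
    intro ⟨n, hn⟩
    have : n < 2 := by nlinarith
    interval_cases n <;> omega
  exact this h3⟩

instance fact_zeta_not_mem : Fact (∀ r : Fr, r ^ 2 ≠ -1 + s * r) := ⟨fun r h => by
  have h1 := congrArg re h
  have h2 := congrArg im h
  simp [sq] at h1 h2
  nlinarith [sq_nonneg r.re, sq_nonneg (r.im - 1 / 2)]⟩

lemma s_sq : s ^ 2 = 3 := by ext <;> simp [sq]

/-- A nontrivial commutative ring with a Euclidean multiplicative norm is a domain and a PID. -/
lemma isDomain_and_isPrincipalIdealRing_of_norm {R : Type*} [CommRing R] [Nontrivial R]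
    (N : R →* ℤ) (h0 : ∀ a, N a = 0 ↔ a = 0)
    (hE : ∀ a b : R, b ≠ 0 → ∃ q, |N (a - b * q)| < |N b|) :
    IsDomain R ∧ IsPrincipalIdealRing R := by
  have hd : NoZeroDivisors R := ⟨fun {a b} hab => by
    have := (h0 (a * b)).2 hab
    rw [map_mul, mul_eq_zero, h0, h0] at this
    exact this⟩
  have hD : IsDomain R := NoZeroDivisors.to_isDomain R
  refine ⟨hD, ⟨fun I => ?_⟩⟩
  by_cases hI : I = ⊥
  · exact hI ▸ inferInstance
  have hex : ∃ n : ℕ, ∃ b ∈ I, b ≠ 0 ∧ (N b).natAbs = n := by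
    obtain ⟨b, hb, hb0⟩ := Submodule.exists_mem_ne_zero_of_ne_bot hI
    exact ⟨_, b, hb, hb0, rfl⟩
  classical
  obtain ⟨b, hb, hb0, hbn⟩ := Nat.find_spec hex
  refine ⟨b, le_antisymm (fun a ha => ?_) ((Submodule.span_singleton_le_iff_mem _ _).2 hb)⟩
  obtain ⟨q, hq⟩ := hE a b hb0
  have hmem : a - b * q ∈ I := I.sub_mem ha (I.mul_mem_right _ hb)
  have hz : a - b * q = 0 := by
    by_contra hne
    have := Nat.find_min' hex ⟨_, hmem, hne, rfl⟩
    rw [← hbn] at this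
    rw [Int.abs_eq_natAbs, Int.abs_eq_natAbs] at hq
    omega
  exact Submodule.mem_span_singleton.2 ⟨q, by rw [smul_eq_mul, mul_comm]; linear_combination -hz⟩

lemma exists_round (a n : ℤ) (hn : n ≠ 0) : ∃ q, (2 * (a - n * q)) ^ 2 ≤ n ^ 2 := by
  refine ⟨round ((a : ℚ) / n), ?_⟩
  have h := abs_sub_round ((a : ℚ) / n)
  have hn' : (n : ℚ) ≠ 0 := by exact_mod_cast hn
  have h2 : ((a : ℚ) / n - round ((a : ℚ) / n)) ^ 2 ≤ (1 / 2) ^ 2 := sq_le_sq' (by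
    linarith [neg_abs_le ((a : ℚ) / n - round ((a : ℚ) / n))]) ((le_abs_self _).trans h)
  have h3 : (n : ℚ) ^ 2 * ((a : ℚ) / n - round ((a : ℚ) / n)) ^ 2 ≤ n ^ 2 * (1 / 2) ^ 2 :=
    mul_le_mul_of_nonneg_left h2 (sq_nonneg _)
  have h4 : (n : ℚ) ^ 2 * ((a : ℚ) / n - round ((a : ℚ) / n)) ^ 2
      = (a - n * round ((a : ℚ) / n)) ^ 2 := by field_simp
  rw [h4] at h3
  have : (2 * ((a : ℚ) - n * round ((a : ℚ) / n))) ^ 2 ≤ n ^ 2 := by nlinarith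
  exact_mod_cast this

lemma norm_Zr_eq_zero_iff (a : Zr) : a.norm = 0 ↔ a = 0 := by
  constructor
  · intro h
    have h' : (⟨a.re, a.im⟩ : Fr).norm = 0 := by
      rw [norm_def] at h ⊢
      simp only
      exact_mod_cast (congrArg (Int.cast : ℤ → ℚ) h)
    rw [norm_eq_zero_iff_eq_zero, QuadraticAlgebra.ext_iff] at h'
    ext
    · simpa using h'.1
    · simpa using h'.2
  · rintro rfl
    simp

lemma Zr_euclidean (a b : Zr) (hb : b ≠ 0) : ∃ q, |(a - b * q).norm| < |b.norm| := by
  set n := b.norm with hn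
  have hn0 : n ≠ 0 := fun h => hb ((norm_Zr_eq_zero_iff b).1 h)
  obtain ⟨q0, h0⟩ := exists_round (a * star b).re n hn0
  obtain ⟨q1, h1⟩ := exists_round (a * star b).im n hn0
  refine ⟨⟨q0, q1⟩, ?_⟩
  have key : (a - b * ⟨q0, q1⟩).norm * n
      = ((a * star b).re - n * q0) ^ 2 - 3 * ((a * star b).im - n * q1) ^ 2 := by
    rw [hn]
    simp only [norm_def, re_mul, im_mul, re_sub, im_sub, re_star, im_star]
    ring
  have hlt : |(a - b * ⟨q0, q1⟩).norm * n| < |n * n| := by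
    rw [key, abs_mul_self, abs_lt]
    have : 0 < n ^ 2 := by positivity
    constructor <;> nlinarith [sq_nonneg ((a * star b).re - n * q0),
      sq_nonneg ((a * star b).im - n * q1)]
  rw [abs_mul, abs_mul] at hlt
  exact lt_of_mul_lt_mul_right hlt (abs_nonneg _)

instance : IsDomain Zr :=
  (isDomain_and_isPrincipalIdealRing_of_norm norm norm_Zr_eq_zero_iff Zr_euclidean).1

instance : IsPrincipalIdealRing Zr :=
  (isDomain_and_isPrincipalIdealRing_of_norm norm norm_Zr_eq_zero_iff Zr_euclidean).2

/-- The inclusion `ℤ[√3] → ℚ(√3)`. -/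
def toFr : Zr →+* Fr where
  toFun a := ⟨a.re, a.im⟩
  map_one' := by ext <;> simp
  map_zero' := by ext <;> simp
  map_mul' a b := by ext <;> simp
  map_add' a b := by ext <;> simp

@[simp] lemma toFr_re (a : Zr) : (toFr a).re = a.re := rfl
@[simp] lemma toFr_im (a : Zr) : (toFr a).im = a.im := rfl

lemma toFr_injective : Function.Injective toFr := by
  intro a b h
  rw [QuadraticAlgebra.ext_iff] at h
  ext
  · simpa using h.1
  · simpa using h.2

lemma toFr_sZ : toFr sZ = s := by ext <;> simp

/-- The inclusion `ℤ[ζ₁₂] → ℚ(ζ₁₂)`. -/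
def toMz : Oz →+* Mz where
  toFun a := ⟨toFr a.re, toFr a.im⟩
  map_one' := by ext1 <;> simp
  map_zero' := by ext1 <;> simp
  map_mul' a b := by ext1 <;> simp [toFr_sZ]
  map_add' a b := by ext1 <;> simp

@[simp] lemma toMz_re (a : Oz) : (toMz a).re = toFr a.re := rfl
@[simp] lemma toMz_im (a : Oz) : (toMz a).im = toFr a.im := rfl

lemma toMz_injective : Function.Injective toMz := by
  intro a b h
  rw [QuadraticAlgebra.ext_iff] at h
  exact QuadraticAlgebra.ext (toFr_injective h.1) (toFr_injective h.2)

lemma toMz_star (a : Oz) : toMz (star a) = star (toMz a) := by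
  ext1 <;> simp [toFr_sZ]

/-- The absolute norm `ℤ[ζ₁₂] → ℤ`. -/
def normOz : Oz →* ℤ := (norm : Zr →* ℤ).comp norm

lemma normOz_eq (a : Oz) : normOz a = (norm a).norm := rfl

lemma normOz_eq_zero_iff (a : Oz) : normOz a = 0 ↔ a = 0 := by
  rw [normOz_eq, norm_Zr_eq_zero_iff]
  constructor
  · intro h
    have h' : (toMz a).norm = 0 := by
      have := congrArg toFr h
      rw [norm_def] at this ⊢
      simpa [toFr_sZ] using this
    rw [norm_eq_zero_iff_eq_zero] at h'
    exact toMz_injective (by simpa using h')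
  · rintro rfl
    simp

lemma norm_Oz_re (a : Oz) : (norm a).re = (a.re.re ^ 2 + 3 * a.re.re * a.im.im + 3 * a.im.im ^ 2)
    + (a.im.re ^ 2 + 3 * a.im.re * a.re.im + 3 * a.re.im ^ 2) := by
  simp [norm_def]
  ring

lemma normOz_nonneg (a : Oz) : 0 ≤ normOz a := by
  have : normOz a = (a.re.re ^ 2 - 3 * a.re.im ^ 2 - 3 * (a.re.im * a.im.re - a.re.re * a.im.im)
      - (a.im.re ^ 2 - 3 * a.im.im ^ 2)) ^ 2 + (a.re.re * a.im.re - 3 * a.re.im * a.im.im) ^ 2 := by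
    rw [normOz_eq, norm_def, norm_def]
    simp
    ring
  rw [this]
  positivity

lemma exists_round_hexagonal (x y n : ℤ) (hn : n ≠ 0) : ∃ p q,
    16 * ((x - n * p) ^ 2 + 3 * (x - n * p) * (y - n * q) + 3 * (y - n * q) ^ 2) ≤ 7 * n ^ 2 := by
  obtain ⟨q, hq⟩ := exists_round y n hn
  obtain ⟨p, hp⟩ := exists_round (2 * x + 3 * (y - n * q)) (2 * n) (by simpa using hn)
  exact ⟨p, q, by nlinarith⟩

lemma normOz_intCast (n : ℤ) : normOz (n : Oz) = n ^ 4 := by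
  rw [normOz_eq, norm_intCast, ← Int.cast_pow, norm_intCast]
  push_cast
  ring

lemma Oz_euclidean (a b : Oz) (hb : b ≠ 0) : ∃ q, |normOz (a - b * q)| < |normOz b| := by
  set n := normOz b with hn
  have hn0 : n ≠ 0 := fun h => hb ((normOz_eq_zero_iff b).1 h)
  obtain ⟨c, hbc⟩ : ∃ c, b * c = (n : Oz) := by
    refine ⟨star b * QuadraticAlgebra.C (star (norm b)), ?_⟩
    rw [← mul_assoc, ← algebraMap_norm_eq_mul_star, C_eq_algebraMap, ← map_mul,
      ← algebraMap_norm_eq_mul_star, ← normOz_eq, ← hn]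
    simp
  obtain ⟨p, q, h1⟩ := exists_round_hexagonal (a * c).re.re (a * c).im.im n hn0
  obtain ⟨p', q', h2⟩ := exists_round_hexagonal (a * c).im.re (a * c).re.im n hn0
  refine ⟨⟨⟨p, q'⟩, ⟨p', q⟩⟩, ?_⟩
  set Q : Oz := ⟨⟨p, q'⟩, ⟨p', q⟩⟩ with hQ
  have key : (a - b * Q) * c = a * c - (n : Oz) * Q := by linear_combination -Q * hbc
  have hnc : normOz b * normOz c = n ^ 4 := by rw [← map_mul, hbc, normOz_intCast]
  have hre := norm_Oz_re (a * c - (n : Oz) * Q)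
  have hpos := normOz_nonneg (a * c - (n : Oz) * Q)
  have hle : normOz (a * c - (n : Oz) * Q) ≤ (norm (a * c - (n : Oz) * Q)).re ^ 2 := by
    rw [normOz_eq, norm_def]
    nlinarith [sq_nonneg (norm (a * c - (n : Oz) * Q)).im]
  have hb1 : 16 * (norm (a * c - (n : Oz) * Q)).re ≤ 14 * n ^ 2 := by
    rw [hre]
    simp [hQ] at h1 h2 ⊢
    nlinarith
  have hb0 : 0 ≤ (norm (a * c - (n : Oz) * Q)).re := by
    rw [hre]
    generalize (a * c - (n : Oz) * Q) = z
    nlinarith [sq_nonneg (2 * z.re.re + 3 * z.im.im), sq_nonneg z.im.im,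
      sq_nonneg (2 * z.im.re + 3 * z.re.im), sq_nonneg z.re.im]
  have hlt : normOz (a - b * Q) * normOz c < normOz b * normOz c := by
    rw [← map_mul, key, hnc]
    have : 0 < n ^ 2 := by positivity
    have h2 := pow_le_pow_left₀ (mul_nonneg (by norm_num) hb0) hb1 2
    have h3 : n ^ 4 = n ^ 2 * n ^ 2 := by ring
    have h4 : 0 < n ^ 2 * n ^ 2 := by positivity
    rw [mul_pow, mul_pow, ← pow_mul, pow_mul n 2 2, sq (n ^ 2)] at h2
    rw [h3]
    linarith
  have hc0 : 0 ≤ normOz c := normOz_nonneg c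
  rw [abs_of_nonneg (normOz_nonneg _), abs_of_nonneg (normOz_nonneg b)]
  exact lt_of_mul_lt_mul_right hlt hc0

instance : IsDomain Oz :=
  (isDomain_and_isPrincipalIdealRing_of_norm normOz normOz_eq_zero_iff Oz_euclidean).1

instance : IsPrincipalIdealRing Oz :=
  (isDomain_and_isPrincipalIdealRing_of_norm normOz normOz_eq_zero_iff Oz_euclidean).2

/-- Reduced fractions: if every element of `K` is a fraction over the principal ideal domain `R`,
it is a fraction in lowest terms. -/
lemma exists_coprime_fraction {R K : Type*} [CommRing R] [IsDomain R] [IsPrincipalIdealRing R]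
    [Field K] (f : R →+* K) (hf : Function.Injective f) (m : K)
    (h : ∃ a c : R, c ≠ 0 ∧ m * f c = f a) :
    ∃ a c : R, c ≠ 0 ∧ IsCoprime a c ∧ m * f c = f a := by
  classical
  obtain ⟨a, c, hc, hm⟩ := h
  let := IsBezout.toGCDDomain R
  obtain ⟨a', ha⟩ := gcd_dvd_left a c
  obtain ⟨c', hc'⟩ := gcd_dvd_right a c
  set g := gcd a c with hg
  have hg0 : g ≠ 0 := by
    intro h
    rw [h, zero_mul] at hc'
    exact hc hc'
  have hcop : IsCoprime a' c' := by
    obtain ⟨x, y, hxy⟩ := exists_gcd_eq_mul_add_mul a c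
    refine ⟨x, y, mul_left_cancel₀ hg0 ?_⟩
    rw [← hg] at hxy
    linear_combination -hxy - x * ha - y * hc'
  refine ⟨a', c', ?_, hcop, ?_⟩
  · rintro rfl
    exact hc (by simpa using hc')
  · have hfg : f g ≠ 0 := by rwa [Ne, map_eq_zero_iff f hf]
    apply mul_left_cancel₀ hfg
    rw [hc', map_mul] at hm
    rw [← map_mul f g a', ← ha, ← hm]
    ring

lemma Fr_fraction (m : Fr) : ∃ a c : Zr, c ≠ 0 ∧ IsCoprime a c ∧ m * toFr c = toFr a := by
  apply exists_coprime_fraction toFr toFr_injective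
  refine ⟨⟨m.re.num * m.im.den, m.im.num * m.re.den⟩, ((m.re.den * m.im.den : ℤ) : Zr), ?_, ?_⟩
  · rw [Ne, Int.cast_eq_zero]
    simp
  · have h1 := Rat.mul_den_eq_num m.re
    have h2 := Rat.mul_den_eq_num m.im
    ext
    · simp
      rw [← h1]
      ring
    · simp
      rw [← h2]
      ring

lemma Mz_fraction (m : Mz) : ∃ a c : Oz, c ≠ 0 ∧ IsCoprime a c ∧ m * toMz c = toMz a := by
  apply exists_coprime_fraction toMz toMz_injective
  obtain ⟨a, c, hc, -, h1⟩ := Fr_fraction m.re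
  obtain ⟨b, d, hd, -, h2⟩ := Fr_fraction m.im
  refine ⟨⟨a * d, b * c⟩, QuadraticAlgebra.C (c * d), ?_, ?_⟩
  · rw [Ne, C_eq_zero_iff]
    exact mul_ne_zero hc hd
  · ext1
    · simp only [toMz_re, re_mul, re_C, im_C, toMz_im, map_zero, mul_zero, add_zero, map_mul, ← h1]
      ring
    · simp only [toMz_re, im_mul, re_C, im_C, toMz_im, map_zero, mul_zero, add_zero, map_mul, ← h2]
      ring

/-- Fundamental unit of `ℤ[√3]`. -/
abbrev εZ : Zr := ⟨2, 1⟩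

/-- Every unit of `ℤ[√3]` is a cube times `1`, `ε` or `ε²`. -/
lemma Zr_unit_cube (u : Zr) (hu : IsUnit u) :
    ∃ j < 3, ∃ w : Zr, IsUnit w ∧ u = εZ ^ j * w ^ 3 := by
  have hε : εZ * star εZ = 1 := by ext <;> simp
  have hεu : IsUnit εZ := IsUnit.of_mul_eq_one _ hε
  have hε'u : IsUnit (star εZ) := IsUnit.of_mul_eq_one εZ (by rw [mul_comm, hε])
  have hmul : ∀ u : Zr, (∃ j < 3, ∃ w : Zr, IsUnit w ∧ u = εZ ^ j * w ^ 3) →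
      ∃ j < 3, ∃ w : Zr, IsUnit w ∧ εZ * u = εZ ^ j * w ^ 3 := by
    rintro _ ⟨j, hj, w, hw, rfl⟩
    interval_cases j
    · exact ⟨1, by norm_num, w, hw, by ring⟩
    · exact ⟨2, by norm_num, w, hw, by ring⟩
    · exact ⟨0, by norm_num, εZ * w, hεu.mul hw, by ring⟩
  have hmul' : ∀ u : Zr, (∃ j < 3, ∃ w : Zr, IsUnit w ∧ u = εZ ^ j * w ^ 3) →
      ∃ j < 3, ∃ w : Zr, IsUnit w ∧ star εZ * u = εZ ^ j * w ^ 3 := by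
    rintro _ ⟨j, hj, w, hw, rfl⟩
    interval_cases j
    · exact ⟨2, by norm_num, star εZ * w, hε'u.mul hw, by
        linear_combination -w ^ 3 * star εZ * (εZ * star εZ + 1) * hε⟩
    · exact ⟨0, by norm_num, w, hw, by linear_combination w ^ 3 * hε⟩
    · exact ⟨1, by norm_num, w, hw, by linear_combination w ^ 3 * εZ * hε⟩
  have hnorm : u.norm = 1 := by
    have h := isUnit_iff_norm_isUnit.1 hu
    rcases Int.isUnit_iff.1 h with h | h
    · exact h
    · exfalso
      rw [norm_def] at h
      have : (u.re * u.re) % 3 = 2 := by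
        rw [show u.re * u.re = 3 * (u.im * u.im) + (-1) by linarith]
        omega
      have h3 : u.re % 3 = 0 ∨ u.re % 3 = 1 ∨ u.re % 3 = 2 := by omega
      rcases h3 with h3 | h3 | h3 <;> simp [Int.mul_emod, h3] at this
  clear hu
  induction hn : u.im.natAbs using Nat.strong_induction_on generalizing u with
  | _ n ih =>
    rw [norm_def] at hnorm
    by_cases him : u.im = 0
    · refine ⟨0, by norm_num, u, ?_, ?_⟩
      · rw [isUnit_iff_norm_isUnit, norm_def, hnorm]
        exact isUnit_one
      · have h1 : u.re ^ 2 = 1 := by rw [him] at hnorm; linarith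
        have : u ^ 2 = 1 := by ext <;> simp [sq, him]; linarith
        linear_combination -u * this
    rcases lt_trichotomy 0 (u.re * u.im) with hpos | hzero | hneg
    · have h1 := ih (star εZ * u).im.natAbs ?_ (star εZ * u) ?_ rfl
      · have := hmul _ h1
        rwa [← mul_assoc, hε, one_mul] at this
      · rw [← hn]
        simp
        rw [Int.natAbs_lt_iff_sq_lt]
        nlinarith [sq_nonneg (u.re - 2 * u.im), Int.one_le_abs him, sq_abs u.im]
      · rw [map_mul, norm_def u, hnorm]
        simp [norm_def]
    · have : u.re = 0 := by simpa [him] using hzero.symm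
      rw [this] at hnorm
      nlinarith [sq_nonneg u.im]
    · have h1 := ih (εZ * u).im.natAbs ?_ (εZ * u) ?_ rfl
      · have := hmul' _ h1
        rwa [← mul_assoc, mul_comm _ εZ, hε, one_mul] at this
      · rw [← hn]
        simp
        rw [Int.natAbs_lt_iff_sq_lt]
        nlinarith
      · rw [map_mul, norm_def u, hnorm]
        simp [norm_def]

/-- The fundamental unit in `ℚ(√3)`. -/
abbrev ε : Fr := ⟨2, 1⟩

lemma toFr_εZ : toFr εZ = ε := by ext <;> simp

lemma ε_sq : ε ^ 2 = 4 * ε - 1 := by ext <;> simp [sq] <;> norm_num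

lemma ε_eq : ε = 2 + s := by ext <;> simp

lemma ε_ne_zero : ε ≠ 0 := by
  intro h
  have := congrArg re h
  norm_num at this

lemma ε_mul_star : ε * star ε = 1 := by ext <;> simp; norm_num

lemma eq_unit_mul_cube_of_norm_eq_cube {m n r : ℤ} (hc : IsCoprime m n) (hodd : ¬ 2 ∣ r)
    (h : m ^ 2 - 3 * n ^ 2 = r ^ 3) : ∃ j, ∃ c : Zr, (⟨m, n⟩ : Zr) = εZ ^ j * c ^ 3 := by
  have h3 : ¬ (3 : ℤ) ∣ m := by
    rintro ⟨k, rfl⟩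
    have h3r : (3 : ℤ) ∣ r := Int.prime_three.dvd_of_dvd_pow
      (⟨3 * k ^ 2 - n ^ 2, by rw [← h]; ring⟩ : (3 : ℤ) ∣ r ^ 3)
    obtain ⟨r', rfl⟩ := h3r
    have h3n : (3 : ℤ) ∣ n := Int.prime_three.dvd_of_dvd_pow
      (⟨k ^ 2 - 3 * r' ^ 3, by linarith⟩ : (3 : ℤ) ∣ n ^ 2)
    have := hc.isUnit_of_dvd' (Dvd.intro k rfl) h3n
    norm_num [Int.isUnit_iff] at this
  have c3 : IsCoprime (3 : ℤ) m := Int.prime_three.coprime_iff_not_dvd.2 h3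
  have c2 : IsCoprime (2 : ℤ) r := Int.prime_two.coprime_iff_not_dvd.2 hodd
  have cm : IsCoprime (r ^ 3) m := by
    have : IsCoprime (-(3 * n ^ 2)) m := (c3.mul_left hc.symm.pow_left).neg_left
    rw [← h, show m ^ 2 - 3 * n ^ 2 = -(3 * n ^ 2) + m * m by ring]
    exact IsCoprime.add_mul_left_left this m
  have c2m : IsCoprime (r ^ 3) (2 * m) := (c2.symm.pow_left).mul_right cm
  have hprod : (⟨m, n⟩ : Zr) * ⟨m, -n⟩ = (r : Zr) ^ 3 := by
    rw [← Int.cast_pow, ← h]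
    ext <;> simp [sq] <;> ring
  have hcop : IsCoprime (⟨m, n⟩ : Zr) ⟨m, -n⟩ := by
    obtain ⟨a, b, hab⟩ := c2m
    have hab' := congrArg (Int.cast : ℤ → Zr) hab
    push_cast at hab'
    have hm : (m : Zr) * 2 = ⟨m, n⟩ + ⟨m, -n⟩ := by ext <;> simp; ring
    refine ⟨a * ⟨m, -n⟩ + b, b, ?_⟩
    linear_combination hab' + a * hprod - b * hm
  obtain ⟨d, u, hu⟩ := exists_associated_pow_of_mul_eq_pow' hcop hprod
  obtain ⟨j, -, w, -, hw⟩ := Zr_unit_cube u u.isUnit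
  exact ⟨j, d * w, by rw [← hu, hw]; ring⟩

lemma Int.cast_eq_cube_of_mul_cube_eq {a b p q : ℤ} (hab : IsCoprime a b) (hpq : IsCoprime p q)
    (h : a * q ^ 3 = p ^ 3 * b) : ∃ r : ℤ, a = r ^ 3 := by
  have h1 : a ∣ p ^ 3 := hab.dvd_of_dvd_mul_right (Dvd.intro _ h)
  have h2 : p ^ 3 ∣ a := (hpq.pow (m := 3) (n := 3)).dvd_of_dvd_mul_right (Dvd.intro _ h.symm)
  rcases Int.associated_iff.1 (associated_of_dvd_dvd h1 h2) with h | h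
  · exact ⟨p, h⟩
  · exact ⟨-p, by rw [h]; ring⟩

lemma isCoprime_of_dvd_four {a b m n x y x' y' : ℤ} (hc : IsCoprime m n) (ha : ¬ 2 ∣ a)
    (h1 : x * a + y * b = 4 * m ^ 2) (h2 : x' * a + y' * b = 4 * n ^ 2) : IsCoprime a b := by
  have h4 : IsCoprime (4 : ℤ) a := by
    have : IsCoprime (2 : ℤ) a := Int.prime_two.coprime_iff_not_dvd.2 ha
    rw [show (4 : ℤ) = 2 ^ 2 by norm_num]
    exact this.pow_left
  obtain ⟨u, v, huv⟩ := (hc.pow (m := 2) (n := 2))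
  obtain ⟨p, q, hpq⟩ := h4
  refine ⟨p * (u * x + v * x') + q, p * (u * y + v * y'), ?_⟩
  linear_combination p * u * h1 + p * v * h2 + 4 * p * huv + hpq

/-- `(t + √3) / (t - √3)` is a power of `ε` times a cube. -/
lemma exists_eq_pow_mul_cube (t X : ℚ) (h : 3 - t ^ 2 = X ^ 3 * (1 + t ^ 2)) :
    ∃ j < 3, ∃ W : Fr, (⟨t, 1⟩ : Fr) = ε ^ j * W ^ 3 * ⟨t, -1⟩ := by
  set m := t.num with hm
  set n : ℤ := (t.den : ℤ) with hn
  have hn0 : n ≠ 0 := by simp [hn]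
  have hmn : IsCoprime m n := Rat.isCoprime_num_den t
  have hpq : IsCoprime X.num (X.den : ℤ) := Rat.isCoprime_num_den X
  have htn : t * n = m := by simp [hn, hm]
  have hn0' : (n : ℚ) ≠ 0 := by exact_mod_cast hn0
  have hI : (3 * n ^ 2 - m ^ 2) * (X.den : ℤ) ^ 3 = X.num ^ 3 * (m ^ 2 + n ^ 2) := by
    have hXd := Rat.mul_den_eq_num X
    have : ((3 * n ^ 2 - m ^ 2) * (X.den : ℚ) ^ 3) = X.num ^ 3 * (m ^ 2 + n ^ 2) := by
      rw [← htn, ← hXd]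
      linear_combination n ^ 2 * (X.den : ℚ) ^ 3 * h
    exact_mod_cast this
  -- it suffices to write a multiple as a unit times a cube
  have reduce : ∀ j : ℕ, ∀ β : Fr, β ≠ 0 → β = n * ⟨t, 1⟩ →
      (∃ W : Fr, β = ε ^ j * W ^ 3 * star β) →
      ∃ j < 3, ∃ W : Fr, (⟨t, 1⟩ : Fr) = ε ^ j * W ^ 3 * ⟨t, -1⟩ := by
    intro j β hβ0 hβ ⟨W, hW⟩
    refine ⟨j % 3, Nat.mod_lt _ (by norm_num), ε ^ (j / 3) * W, ?_⟩
    have hnF : (n : Fr) ≠ 0 := by exact_mod_cast hn0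
    apply mul_left_cancel₀ hnF
    have hst : star β = n * ⟨t, -1⟩ := by rw [hβ]; ext <;> simp
    rw [← hβ, hW, hst]
    conv_lhs => rw [← Nat.mod_add_div j 3, pow_add, pow_mul']
    ring
  have hne : ∀ a b : ℤ, (⟨a, b⟩ : Zr) ≠ 0 → ∀ j : ℕ, ∀ c : Zr, ⟨a, b⟩ = εZ ^ j * c ^ 3 →
      ∃ W : Fr, toFr ⟨a, b⟩ = ε ^ (2 * j) * W ^ 3 * star (toFr ⟨a, b⟩) := by
    intro a b hab j c hc
    have hc0 : toFr c ≠ 0 := by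
      rw [Ne, map_eq_zero_iff _ toFr_injective]
      rintro rfl
      exact hab (by simpa using hc)
    have hs0 : star (toFr c) ≠ 0 := by simpa using hc0
    refine ⟨toFr c / star (toFr c), ?_⟩
    rw [hc, map_mul, map_pow, map_pow, toFr_εZ, star_mul', star_pow, star_pow]
    have h1 : ε ^ j * star ε ^ j = 1 := by rw [← mul_pow, ε_mul_star, one_pow]
    field_simp
    linear_combination (-1) * ε ^ j * h1
  by_cases hpar : (2 : ℤ) ∣ 3 * n ^ 2 - m ^ 2
  · have hodd : ¬ (2 : ℤ) ∣ m ∧ ¬ (2 : ℤ) ∣ n := by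
      have h2 : ¬ ((2 : ℤ) ∣ m ∧ (2 : ℤ) ∣ n) := by
        rintro ⟨ha, hb⟩
        have := hmn.isUnit_of_dvd' ha hb
        norm_num [Int.isUnit_iff] at this
      have h3 : (2 : ℤ) ∣ m ↔ (2 : ℤ) ∣ n := by
        constructor
        · intro ha
          apply Int.prime_two.dvd_of_dvd_pow (n := 2)
          have := dvd_pow ha two_ne_zero
          omega
        · intro ha
          apply Int.prime_two.dvd_of_dvd_pow (n := 2)
          have := dvd_pow ha two_ne_zero
          omega
      tauto
    obtain ⟨n1, hn1⟩ : ∃ n1, m = n + 2 * n1 := ⟨(m - n) / 2, by omega⟩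
    obtain ⟨m1, hm1⟩ : ∃ m1, n = m1 + n1 := ⟨n - n1, by omega⟩
    have hm1' : m = m1 + 3 * n1 := by omega
    have hc1 : IsCoprime m1 n1 := by
      obtain ⟨a, b, hab⟩ := hmn
      exact ⟨a + b, 3 * a + b, by rw [← hab, hm1', hm1]; ring⟩
    have hodd1 : ¬ (2 : ℤ) ∣ m1 ^ 2 - 3 * n1 ^ 2 := by
      intro hd
      apply hodd.2
      apply Int.prime_two.dvd_of_dvd_pow (n := 2)
      rw [hm1, show (m1 + n1) ^ 2 = m1 ^ 2 - 3 * n1 ^ 2 + 2 * (m1 * n1 + 2 * n1 ^ 2) by ring]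
      exact dvd_add hd (Dvd.intro _ rfl)
    have hI1 : (m1 ^ 2 - 3 * n1 ^ 2) * (X.den : ℤ) ^ 3
        = X.num ^ 3 * (m1 ^ 2 + 4 * m1 * n1 + 5 * n1 ^ 2) := by
      rw [hm1', hm1] at hI
      linarith
    have hcop : IsCoprime (m1 ^ 2 - 3 * n1 ^ 2) (m1 ^ 2 + 4 * m1 * n1 + 5 * n1 ^ 2) := by
      apply isCoprime_of_dvd_four (x := -2) (y := 6) (x' := 2) (y' := 2) hmn hodd1
      · rw [hm1']; ring
      · rw [hm1]; ring
    obtain ⟨r, hr⟩ := Int.cast_eq_cube_of_mul_cube_eq hcop hpq hI1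
    obtain ⟨j, c, hjc⟩ := eq_unit_mul_cube_of_norm_eq_cube hc1 (fun hd => hodd1
      (hr ▸ dvd_pow hd three_ne_zero)) hr
    have hz : (⟨m1, n1⟩ : Zr) ≠ 0 := by
      intro h0
      rw [QuadraticAlgebra.ext_iff] at h0
      simp at h0
      rw [h0.1, h0.2] at hm1
      exact hn0 (by simpa using hm1)
    obtain ⟨W, hW⟩ := hne m1 n1 hz j c hjc
    have hβ : (⟨1, 1⟩ : Fr) * toFr ⟨m1, n1⟩ = n * ⟨t, 1⟩ := by
      ext
      · simp
        rw [mul_comm (n : ℚ), htn, hm1']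
        push_cast
        ring
      · simp [hm1]
        ring
    refine reduce (2 * j + 1) _ ?_ hβ ⟨-W, ?_⟩
    · rw [hβ]
      refine mul_ne_zero (by exact_mod_cast hn0) (fun h0 => ?_)
      have := congrArg im h0
      simp at this
    · have h1 : (⟨1, 1⟩ : Fr) = -ε * star ⟨1, 1⟩ := by ext <;> simp <;> norm_num
      rw [star_mul', pow_succ]
      conv_lhs => rw [h1, hW]
      ring
  · have hcop : IsCoprime (3 * n ^ 2 - m ^ 2) (m ^ 2 + n ^ 2) :=
      isCoprime_of_dvd_four (x := -1) (y := 3) (x' := 1) (y' := 1) hmn hpar (by ring) (by ring)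
    obtain ⟨r, hr⟩ := Int.cast_eq_cube_of_mul_cube_eq hcop hpq hI
    obtain ⟨j, c, hjc⟩ := eq_unit_mul_cube_of_norm_eq_cube (r := -r) hmn
      (fun hd => hpar (hr ▸ dvd_pow (by simpa using hd) three_ne_zero)) (by linarith [Odd.neg_pow (by decide : Odd 3) r])
    have hz : (⟨m, n⟩ : Zr) ≠ 0 := fun h0 => hn0 (congrArg im h0)
    obtain ⟨W, hW⟩ := hne m n hz j c hjc
    refine reduce (2 * j) _ ?_ ?_ ⟨W, hW⟩
    · rwa [Ne, map_eq_zero_iff _ toFr_injective]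
    · ext <;> simp [← htn]
      ring

lemma cubic_eq_three_mul_cube {σ T : ℚ} (hT : T ≠ 0) (h : σ ^ 3 - 3 * σ + 1 = 3 * T ^ 3) :
    T = 1 ∨ T = -1 / 2 := by
  have hflt := (fermatLastTheoremFor_iff_rat (n := 3)).1 fermatLastTheoremThree
  have hh : σ ^ 2 - σ + 1 ≠ 0 := by nlinarith [sq_nonneg (2 * σ - 1)]
  have hsum : ((9 * T ^ 3 + (σ ^ 3 - 6 * σ ^ 2 + 3 * σ + 1)) / 2) ^ 3
      + ((9 * T ^ 3 - (σ ^ 3 - 6 * σ ^ 2 + 3 * σ + 1)) / 2) ^ 3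
      = (3 * T * (σ ^ 2 - σ + 1)) ^ 3 := by
    have : T ^ 3 = (σ ^ 3 - 3 * σ + 1) / 3 := by linarith
    rw [mul_pow, mul_pow, this]
    ring
  have hor : (9 * T ^ 3 + (σ ^ 3 - 6 * σ ^ 2 + 3 * σ + 1)) / 2 = 0 ∨
      (9 * T ^ 3 - (σ ^ 3 - 6 * σ ^ 2 + 3 * σ + 1)) / 2 = 0 := by
    by_contra! hcon
    exact hflt _ _ _ hcon.1 hcon.2 (mul_ne_zero (mul_ne_zero (by norm_num) hT) hh) hsum
  have cube_inj : ∀ a b : ℚ, a ^ 3 = b ^ 3 → a = b := fun a b hab =>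
    (Odd.strictMono_pow (by decide : Odd 3)).injective hab
  rcases hor with h0 | h0
  · have : (σ + 1) * ((2 * σ - 1) * (σ - 2)) = 0 := by linear_combination h0 + 3 / 2 * h
    rcases mul_eq_zero.1 this with h1 | h1
    · left
      apply cube_inj
      obtain rfl : σ = -1 := by linarith
      linarith
    rcases mul_eq_zero.1 h1 with h1 | h1
    · right
      apply cube_inj
      obtain rfl : σ = 1 / 2 := by linarith
      linarith
    · left
      apply cube_inj
      obtain rfl : σ = 2 := by linarith
      linarith
  · exfalso
    have h1 : σ ^ 3 + 3 * σ ^ 2 - 6 * σ + 1 = 0 := by linear_combination h0 + 3 / 2 * h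
    have hd : σ * σ.den = σ.num := Rat.mul_den_eq_num σ
    have h2 : (σ.num : ℚ) ^ 3 + 3 * σ.num ^ 2 * σ.den - 6 * σ.num * σ.den ^ 2 + σ.den ^ 3 = 0 := by
      rw [← hd]
      linear_combination (σ.den : ℚ) ^ 3 * h1
    have h3 : σ.num ^ 3 + 3 * σ.num ^ 2 * (σ.den : ℤ) - 6 * σ.num * (σ.den : ℤ) ^ 2
        + (σ.den : ℤ) ^ 3 = 0 := by exact_mod_cast h2
    have hc : IsCoprime σ.num (σ.den : ℤ) := Rat.isCoprime_num_den σ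
    generalize σ.num = a, (σ.den : ℤ) = b at h3 hc
    have hab : (2 : ℤ) ∣ a ∧ (2 : ℤ) ∣ b := by
      have h4 := congrArg (Int.cast : ℤ → ZMod 2) h3
      push_cast at h4
      have e1 := ZMod.intCast_zmod_eq_zero_iff_dvd a 2
      have e2 := ZMod.intCast_zmod_eq_zero_iff_dvd b 2
      push_cast at e1 e2
      rw [← e1, ← e2]
      generalize (a : ZMod 2) = x, (b : ZMod 2) = y at h4
      revert x y
      decide
    have := hc.isUnit_of_dvd' hab.1 hab.2
    norm_num [Int.isUnit_iff] at this

lemma norm_eq_one_of_eq_mul_cube {t : ℚ} {j : ℕ} {W : Fr}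
    (h : (⟨t, 1⟩ : Fr) = ε ^ j * W ^ 3 * ⟨t, -1⟩) : norm W = 1 := by
  have hε : norm ε = 1 := by norm_num [norm_def]
  have h1 := congrArg QuadraticAlgebra.norm h
  rw [map_mul, map_mul, map_pow, map_pow, hε] at h1
  have hs : norm (⟨t, 1⟩ : Fr) = norm (⟨t, -1⟩ : Fr) := by simp [norm_def]
  have h0 : norm (⟨t, -1⟩ : Fr) ≠ 0 := by
    rw [Ne, norm_eq_zero_iff_eq_zero]
    intro h0
    have := congrArg im h0
    simp at this
  rw [hs] at h1
  have : (norm W) ^ 3 = 1 := by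
    apply mul_right_cancel₀ h0
    rw [one_mul]
    simpa using h1.symm
  exact (Odd.strictMono_pow (by decide : Odd 3)).injective (by simpa using this)

/-- The case in which `(t + √3) / (t - √3)` is a cube. -/
lemma eq_neg_one_or_two_of_cube {t X : ℚ} {W : Fr} (hX : X ≠ 0)
    (ht : 3 - t ^ 2 = X ^ 3 * (1 + t ^ 2)) (h : (⟨t, 1⟩ : Fr) = W ^ 3 * ⟨t, -1⟩) :
    X = -1 ∨ X = 2 := by
  have hN : norm W = 1 := norm_eq_one_of_eq_mul_cube (j := 0) (t := t) (by simpa using h)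
  rw [norm_def] at hN
  have h1 := congrArg re h
  have h2 := congrArg im h
  have hre : (W ^ 3).re = W.re ^ 3 + 9 * W.re * W.im ^ 2 := by simp [pow_succ]; ring
  have him : (W ^ 3).im = 3 * W.re ^ 2 * W.im + 3 * W.im ^ 3 := by simp [pow_succ]; ring
  simp only [re_mul, im_mul, hre, him] at h1 h2
  set σ := 2 * W.re with hσ
  have hσ3 : 2 * (W.re ^ 3 + 9 * W.re * W.im ^ 2) = σ ^ 3 - 3 * σ := by
    rw [hσ]
    linear_combination (-6) * W.re * hN
  have ht3 : (t ^ 2 - 3) * (σ ^ 3 - 3 * σ) = 2 * (t ^ 2 + 3) := by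
    rw [← hσ3]
    linear_combination (-2) * t * h1 + (-6) * h2
  have hp : 0 < 1 + t ^ 2 := by positivity
  have hfin : σ ^ 3 - 3 * σ + 1 = 3 * (-1 / X) ^ 3 := by
    have : (1 + t ^ 2) * (X ^ 3 * (σ ^ 3 - 3 * σ + 1) + 3) = 0 := by
      linear_combination (-1 * (σ ^ 3 - 3 * σ + 1)) * ht - ht3
    have h0 := (mul_eq_zero.1 this).resolve_left hp.ne'
    field_simp
    linarith
  rcases cubic_eq_three_mul_cube (div_ne_zero (by norm_num) hX) hfin with h3 | h3
  · left
    field_simp at h3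
    linarith
  · right
    field_simp at h3
    linarith

section Mordell

variable {K : Type*} [Field K] {k : K}

/-- The Mordell curve `y² = x³ + k`. -/
def mordell {K : Type*} [Field K] (k : K) : WeierstrassCurve.Affine K := ⟨0, 0, 0, 0, k⟩

/-- The point `P` is affine, with coordinates `(x, y)`. -/
def IsAt {K : Type*} [Field K] {k : K} (P : (mordell k).Point) (x y : K) : Prop :=
  ∃ h, P = .some x y h

lemma mordell_equation_iff {x y : K} : (mordell k).Equation x y ↔ y ^ 2 = x ^ 3 + k := by
  rw [WeierstrassCurve.Affine.equation_iff]
  simp [mordell]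

lemma exists_isAt [CharZero K] (hk : k ≠ 0) {x y : K} (h : y ^ 2 = x ^ 3 + k) :
    ∃ P : (mordell k).Point, IsAt P x y := by
  refine ⟨.some x y ?_, _, rfl⟩
  rw [← WeierstrassCurve.Affine.equation_iff_nonsingular_of_Δ_ne_zero, mordell_equation_iff]
  · exact h
  · simp [mordell, WeierstrassCurve.Δ, WeierstrassCurve.b₂, WeierstrassCurve.b₄,
      WeierstrassCurve.b₆, WeierstrassCurve.b₈, hk]

lemma eq_zero_or_isAt (P : (mordell k).Point) : P = 0 ∨ ∃ x y, IsAt P x y := by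
  cases P with
  | zero => exact Or.inl rfl
  | some x y h => exact Or.inr ⟨x, y, h, rfl⟩

namespace IsAt

variable {P Q : (mordell k).Point} {x y x₁ y₁ x₂ y₂ x₃ y₃ l : K}

lemma equation (h : IsAt P x y) : y ^ 2 = x ^ 3 + k := by
  obtain ⟨h, -⟩ := h
  exact mordell_equation_iff.1 h.1

lemma ne_zero (h : IsAt P x y) : P ≠ 0 := by
  obtain ⟨h, rfl⟩ := h
  exact WeierstrassCurve.Affine.Point.some_ne_zero h

lemma ext (h : IsAt P x y) (h' : IsAt Q x y) : P = Q := by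
  obtain ⟨h, rfl⟩ := h
  obtain ⟨h', rfl⟩ := h'
  rfl

lemma unique (h : IsAt P x₁ y₁) (h' : IsAt P x₂ y₂) : x₁ = x₂ ∧ y₁ = y₂ := by
  obtain ⟨h, rfl⟩ := h
  obtain ⟨h', e⟩ := h'
  injection e with e1 e2
  exact ⟨e1, e2⟩

lemma neg (h : IsAt P x y) : IsAt (-P) x (-y) := by
  obtain ⟨h, rfl⟩ := h
  have : (mordell k).negY x y = -y := by simp [WeierstrassCurve.Affine.negY, mordell]
  rw [WeierstrassCurve.Affine.Point.neg_some]
  exact this ▸ ⟨_, rfl⟩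

lemma eq_or_eq_neg (h : IsAt P x y₁) (h' : IsAt Q x y₂) : P = Q ∨ P = -Q := by
  have : (y₁ - y₂) * (y₁ + y₂) = 0 := by linear_combination h.equation - h'.equation
  rcases mul_eq_zero.1 this with h0 | h0
  · obtain rfl : y₁ = y₂ := by linear_combination h0
    exact Or.inl (h.ext h')
  · obtain rfl : y₁ = -y₂ := by linear_combination h0
    exact Or.inr (h.ext h'.neg)

lemma add [DecidableEq K] (h₁ : IsAt P x₁ y₁) (h₂ : IsAt Q x₂ y₂) (hx : x₁ ≠ x₂)
    (hl : l * (x₁ - x₂) = y₁ - y₂) (hx₃ : x₃ = l ^ 2 - x₁ - x₂) (hy₃ : y₃ = -(l * (x₃ - x₁) + y₁)) :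
    IsAt (P + Q) x₃ y₃ := by
  obtain ⟨h₁, rfl⟩ := h₁
  obtain ⟨h₂, rfl⟩ := h₂
  rw [WeierstrassCurve.Affine.Point.add_of_X_ne hx]
  have hs : (mordell k).slope x₁ x₂ y₁ y₂ = l := by
    rw [WeierstrassCurve.Affine.slope_of_X_ne hx, ← hl, mul_div_cancel_right₀ _ (sub_ne_zero.2 hx)]
  have e1 : (mordell k).addX x₁ x₂ ((mordell k).slope x₁ x₂ y₁ y₂) = x₃ := by
    rw [hs, hx₃]
    simp [WeierstrassCurve.Affine.addX, mordell]
  have e2 : (mordell k).addY x₁ x₂ y₁ ((mordell k).slope x₁ x₂ y₁ y₂) = y₃ := by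
    rw [hs] at e1
    rw [hs, WeierstrassCurve.Affine.addY, WeierstrassCurve.Affine.negAddY,
      WeierstrassCurve.Affine.negY, e1, hy₃]
    simp [mordell]
  exact e1 ▸ e2 ▸ ⟨_, rfl⟩

lemma double [CharZero K] [DecidableEq K] (h : IsAt P x y) (hy : y ≠ 0) (hl : l * (2 * y) = 3 * x ^ 2)
    (hx₃ : x₃ = l ^ 2 - 2 * x) (hy₃ : y₃ = -(l * (x₃ - x) + y)) : IsAt (P + P) x₃ y₃ := by
  obtain ⟨h, rfl⟩ := h
  have hn : (mordell k).negY x y = -y := by simp [WeierstrassCurve.Affine.negY, mordell]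
  have hy' : y ≠ (mordell k).negY x y := by
    rw [hn]
    intro e
    exact hy (self_eq_neg.1 e)
  rw [WeierstrassCurve.Affine.Point.add_self_of_Y_ne hy']
  have hs : (mordell k).slope x x y y = l := by
    rw [WeierstrassCurve.Affine.slope_of_Y_ne rfl hy', hn]
    have : y - -y ≠ 0 := by
      rw [sub_neg_eq_add, ← two_mul]
      exact mul_ne_zero two_ne_zero hy
    rw [div_eq_iff this]
    simp [mordell]
    linear_combination -hl
  have e1 : (mordell k).addX x x ((mordell k).slope x x y y) = x₃ := by
    rw [hs, hx₃]
    simp [WeierstrassCurve.Affine.addX, mordell]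
    ring
  have e2 : (mordell k).addY x x y ((mordell k).slope x x y y) = y₃ := by
    rw [hs] at e1
    rw [hs, WeierstrassCurve.Affine.addY, WeierstrassCurve.Affine.negAddY,
      WeierstrassCurve.Affine.negY, e1, hy₃]
    simp [mordell]
  exact e1 ▸ e2 ▸ ⟨_, rfl⟩

/-- The tripling formula on `y² = x³ + k`. -/
lemma triple [CharZero K] [DecidableEq K] (h : IsAt P x y) (hx : x ≠ 0) (hy : y ≠ 0) (h4 : x ^ 3 + 4 * k ≠ 0) :
    IsAt ((3 : ℕ) • P)
      ((x ^ 9 - 96 * k * x ^ 6 + 48 * k ^ 2 * x ^ 3 + 64 * k ^ 3) / (9 * x ^ 2 * (x ^ 3 + 4 * k) ^ 2))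
      (y * ((x ^ 3 - 8 * k) * ((x ^ 3 + 4 * k) ^ 3 + 216 * k * x ^ 6))
        / (27 * x ^ 3 * (x ^ 3 + 4 * k) ^ 3)) := by
  have he := h.equation
  have hk : k = y ^ 2 - x ^ 3 := by linear_combination -he
  have h2 : IsAt (P + P) ((x ^ 4 - 8 * k * x) / (4 * y ^ 2))
      ((x ^ 6 + 20 * k * x ^ 3 - 8 * k ^ 2) / (8 * y ^ 3)) := by
    refine h.double (l := 3 * x ^ 2 / (2 * y)) hy ?_ ?_ ?_
    · field_simp
    · field_simp
      rw [hk]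
      ring
    · field_simp
      rw [hk]
      ring
  have hd : (x ^ 4 - 8 * k * x) / (4 * y ^ 2) - x = -3 * x * (x ^ 3 + 4 * k) / (4 * y ^ 2) := by
    field_simp
    rw [hk]
    ring
  have hne : (x ^ 4 - 8 * k * x) / (4 * y ^ 2) ≠ x := by
    rw [← sub_ne_zero, hd]
    exact div_ne_zero (mul_ne_zero (mul_ne_zero (by norm_num) hx) h4)
      (mul_ne_zero (by norm_num) (pow_ne_zero _ hy))
  rw [show (3 : ℕ) • P = P + (P + P) by rw [succ_nsmul', two_nsmul]]
  have hM : y ^ 2 = x ^ 3 + k := he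
  have h4' : x ^ 3 + k * 4 ≠ 0 := by rwa [mul_comm k]
  refine h.add (l := (7 * x ^ 6 - 4 * k * x ^ 3 + 16 * k ^ 2) / (6 * y * x * (x ^ 3 + 4 * k)))
    h2 hne.symm ?_ ?_ ?_
  · rw [← neg_sub _ x, hd]
    field_simp
    rw [hk]
    ring
  · field_simp
    rw [hM]
    ring
  · field_simp
    rw [hM]
    ring

end IsAt

end Mordell

/-- A primitive cube root of unity in `ℤ[ζ₁₂]`. -/
abbrev ωO : Oz := ⟨-2, sZ⟩

/-- A square root of `-1` in `ℤ[ζ₁₂]`. -/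
abbrev iO : Oz := ⟨-sZ, 2⟩

lemma iO_sq : iO ^ 2 = -1 := by ext <;> simp [sq]

lemma star_iO : star iO = -iO := by ext <;> simp

lemma hexagonal_eq_zero {x y : ℤ} (h : x ^ 2 + 3 * x * y + 3 * y ^ 2 = 0) : x = 0 ∧ y = 0 := by
  have hy : y ^ 2 = 0 := by nlinarith [sq_nonneg (2 * x + 3 * y), sq_nonneg y]
  have hy : y = 0 := by simpa using hy
  subst hy
  exact ⟨by simpa using h, rfl⟩

lemma hexagonal_eq_one {x y : ℤ} (h : x ^ 2 + 3 * x * y + 3 * y ^ 2 = 1) :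
    (x = 1 ∧ y = 0) ∨ (x = -1 ∧ y = 0) ∨ (x = -2 ∧ y = 1) ∨ (x = 2 ∧ y = -1) ∨
      (x = -1 ∧ y = 1) ∨ (x = 1 ∧ y = -1) := by
  have h1 : -1 ≤ y := by nlinarith [sq_nonneg (2 * x + 3 * y)]
  have h2 : y ≤ 1 := by nlinarith [sq_nonneg (2 * x + 3 * y)]
  have h3 : -2 ≤ x := by nlinarith [sq_nonneg (x + 2 * y)]
  have h4 : x ≤ 2 := by nlinarith [sq_nonneg (x + 2 * y)]
  interval_cases y <;> interval_cases x <;> simp_all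

/-- Elements of `ℤ[ζ₁₂]` of relative norm `1` are cubes up to cube roots of unity. -/
lemma exists_eq_omega_mul_cube {v : Oz} (hv : v * star v = 1) :
    ∃ k < 3, ∃ w : Oz, v = ωO ^ k * w ^ 3 := by
  have hn : norm v = 1 := by
    rw [← algebraMap_norm_eq_mul_star] at hv
    exact algebraMap_injective (hv.trans (map_one _).symm)
  have hre := norm_Oz_re v
  rw [hn, re_one] at hre
  have p1 : 0 ≤ v.re.re ^ 2 + 3 * v.re.re * v.im.im + 3 * v.im.im ^ 2 := by
    nlinarith [sq_nonneg (2 * v.re.re + 3 * v.im.im), sq_nonneg v.im.im]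
  have p2 : 0 ≤ v.im.re ^ 2 + 3 * v.im.re * v.re.im + 3 * v.re.im ^ 2 := by
    nlinarith [sq_nonneg (2 * v.im.re + 3 * v.re.im), sq_nonneg v.re.im]
  obtain ⟨⟨x0, x1⟩, ⟨y0, y1⟩⟩ := v
  simp only at hre p1 p2
  by_cases h0 : x0 ^ 2 + 3 * x0 * y1 + 3 * y1 ^ 2 = 0
  · obtain ⟨rfl, rfl⟩ := hexagonal_eq_zero h0
    rcases hexagonal_eq_one (x := y0) (y := x1) (by linarith) with
      ⟨rfl, rfl⟩ | ⟨rfl, rfl⟩ | ⟨rfl, rfl⟩ | ⟨rfl, rfl⟩ | ⟨rfl, rfl⟩ | ⟨rfl, rfl⟩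
    · exact ⟨1, by norm_num, iO, by ext <;> simp [pow_succ]⟩
    · exact ⟨1, by norm_num, -iO, by ext <;> simp [pow_succ]⟩
    · exact ⟨0, by norm_num, iO, by ext <;> simp [pow_succ]⟩
    · exact ⟨0, by norm_num, -iO, by ext <;> simp [pow_succ]⟩
    · exact ⟨2, by norm_num, -iO, by ext <;> simp [pow_succ]⟩
    · exact ⟨2, by norm_num, iO, by ext <;> simp [pow_succ]⟩
  · have h1 : y0 ^ 2 + 3 * y0 * x1 + 3 * x1 ^ 2 = 0 := by omega
    obtain ⟨rfl, rfl⟩ := hexagonal_eq_zero h1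
    rcases hexagonal_eq_one (x := x0) (y := y1) (by linarith) with
      ⟨rfl, rfl⟩ | ⟨rfl, rfl⟩ | ⟨rfl, rfl⟩ | ⟨rfl, rfl⟩ | ⟨rfl, rfl⟩ | ⟨rfl, rfl⟩
    · exact ⟨0, by norm_num, 1, by ext <;> simp⟩
    · exact ⟨0, by norm_num, -1, by ext <;> simp [pow_succ]⟩
    · exact ⟨1, by norm_num, 1, by ext <;> simp [pow_succ]⟩
    · exact ⟨1, by norm_num, -1, by ext <;> simp [pow_succ]⟩
    · exact ⟨2, by norm_num, -1, by ext <;> simp [pow_succ]⟩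
    · exact ⟨2, by norm_num, 1, by ext <;> simp [pow_succ]⟩

lemma normOz_isUnit_iff {a : Oz} : IsUnit a ↔ IsUnit (normOz a) := by
  rw [isUnit_iff_norm_isUnit, isUnit_iff_norm_isUnit, normOz_eq]

/-- The prime `1 + i` above `2`. -/
lemma prime_one_add_i : Prime (1 + iO) := by
  have hN : normOz (1 + iO) = 4 := by simp [normOz_eq, norm_def]
  apply Irreducible.prime
  refine ⟨fun h => ?_, fun a b hab => ?_⟩
  · rw [normOz_isUnit_iff, hN] at h
    norm_num [Int.isUnit_iff] at h
  · rw [normOz_isUnit_iff, normOz_isUnit_iff]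
    have h1 : normOz a * normOz b = 4 := by rw [← map_mul, ← hab, hN]
    have ha := normOz_nonneg a
    have hb := normOz_nonneg b
    have h2 : ∀ z : Oz, normOz z ≠ 2 := by
      intro z hz
      rw [normOz_eq, norm_def] at hz
      have : ((norm z).re * (norm z).re) % 3 = 2 := by
        rw [show (norm z).re * (norm z).re = 3 * ((norm z).im * (norm z).im) + 2 by linarith]
        omega
      have h3 : (norm z).re % 3 = 0 ∨ (norm z).re % 3 = 1 ∨ (norm z).re % 3 = 2 := by omega
      rcases h3 with h3 | h3 | h3 <;> simp [Int.mul_emod, h3] at this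
    have ha2 := h2 a
    have hb2 := h2 b
    rw [Int.isUnit_iff, Int.isUnit_iff]
    generalize normOz a = A, normOz b = B at *
    have hB1 : 1 ≤ B := by
      rcases hb.eq_or_lt with rfl | hb
      · omega
      · omega
    have : A ≤ 4 := by nlinarith
    interval_cases A <;> omega

lemma pow_mul_eq_pow_mul {R : Type*} [CommRing R] [IsDomain R] {p x y : R} (hp : p ≠ 0)
    (hx : ¬ p ∣ x) (hy : ¬ p ∣ y) {m n : ℕ} (h : p ^ m * x = p ^ n * y) : m = n := by
  rcases lt_trichotomy m n with hlt | heq | hlt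
  · obtain ⟨d, rfl⟩ := Nat.exists_eq_add_of_lt hlt
    refine absurd ⟨p ^ d * y, ?_⟩ hx
    apply mul_left_cancel₀ (pow_ne_zero m hp)
    rw [h]
    ring
  · exact heq
  · obtain ⟨d, rfl⟩ := Nat.exists_eq_add_of_lt hlt
    refine absurd ⟨p ^ d * x, ?_⟩ hy
    apply mul_left_cancel₀ (pow_ne_zero n hp)
    rw [← h]
    ring

lemma eq_unit_mul_cube_of_norm_associated {a B : Oz} (ha : a ≠ 0)
    (h : Associated (B ^ 3) (a * star a)) (h8 : ∀ g, g ∣ a → g ∣ star a → g ∣ 8) :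
    ∃ u d : Oz, IsUnit u ∧ a = u * d ^ 3 := by
  set p := 1 + iO with hp
  have hpp : Prime p := prime_one_add_i
  have hi : IsUnit iO := IsUnit.of_mul_eq_one (-iO) (by linear_combination -iO_sq)
  have hps : star p = -iO * p := by
    rw [hp, star_add, star_iO, star_one]
    linear_combination iO_sq
  have h2 : (8 : Oz) * iO = -p ^ 6 := by
    rw [hp]
    linear_combination (iO ^ 4 + 6 * iO ^ 3 + 14 * iO ^ 2 + 14 * iO + 1) * iO_sq
  clear_value p
  have hB : B ≠ 0 := by
    rintro rfl
    rw [zero_pow three_ne_zero, Associated.comm, associated_zero_iff_eq_zero, mul_eq_zero,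
      star_eq_zero, or_self] at h
    exact ha h
  obtain ⟨e, β, hβ, hae⟩ := WfDvdMonoid.max_power_factor' ha hpp.not_isUnit
  obtain ⟨f, B', hB', hBf⟩ := WfDvdMonoid.max_power_factor' hB hpp.not_isUnit
  have hβs : ¬ p ∣ star β := by
    rintro ⟨z, hz⟩
    apply hβ
    refine ⟨-iO * star z, ?_⟩
    rw [← star_star β, hz, star_mul', hps]
    ring
  obtain ⟨u, hu⟩ := h
  have hnot : ¬ p ∣ B' ^ 3 * u := by
    intro hd
    rw [Units.dvd_mul_right] at hd
    exact hB' (hpp.dvd_of_dvd_pow hd)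
  have hnot' : ¬ p ∣ (-iO) ^ e * (β * star β) := by
    intro hd
    rw [IsUnit.dvd_mul_left (hi.neg.pow e)] at hd
    exact (hpp.dvd_or_dvd hd).elim hβ hβs
  have heq : p ^ (2 * e) * ((-iO) ^ e * (β * star β)) = p ^ (3 * f) * (B' ^ 3 * u) := by
    rw [hae, hBf, star_mul', star_pow, hps, mul_pow (-iO)] at hu
    linear_combination -hu
  have hef := pow_mul_eq_pow_mul hpp.ne_zero hnot' hnot heq
  rw [hef] at heq
  have heq' := mul_left_cancel₀ (pow_ne_zero _ hpp.ne_zero) heq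
  have hcop : IsCoprime β (star β) := by
    rw [← isRelPrime_iff_isCoprime]
    intro g hg hg'
    have h1 : g ∣ 8 := h8 g (hae ▸ hg.mul_left _) (by
      rw [hae, star_mul']
      exact hg'.mul_left _)
    have h3 : g ∣ p ^ 6 := by
      rw [← dvd_neg, ← h2]
      exact h1.mul_right _
    obtain ⟨n, -, hn⟩ := (dvd_prime_pow hpp 6).1 h3
    rcases Nat.eq_zero_or_pos n with rfl | hn0
    · rw [pow_zero] at hn
      exact hn.isUnit_iff.2 isUnit_one  
    · exact absurd (((dvd_pow_self p hn0.ne').trans hn.symm.dvd).trans hg) hβ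
  have hass : Associated (B' ^ 3) (β * star β) := by
    refine Associated.trans ⟨u, heq'.symm⟩ ?_
    exact (associated_isUnit_mul_left_iff (hi.neg.pow e)).2 (Associated.refl _)
  obtain ⟨d, w, hw⟩ := exists_associated_pow_of_associated_pow_mul hcop hass
  obtain ⟨e', rfl⟩ : ∃ e', e = 3 * e' := ⟨e / 3, by omega⟩
  exact ⟨w, p ^ e' * d, w.isUnit, by rw [hae, ← hw]; ring⟩

/-- A primitive cube root of unity in `ℚ(ζ₁₂)`. -/
abbrev ωM : Mz := ⟨-2, s⟩

/-- A square root of `-1` in `ℚ(ζ₁₂)`. -/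
abbrev iM : Mz := ⟨-s, 2⟩

lemma ωM_cube : ωM ^ 3 = 1 := by ext <;> simp [pow_succ] <;> norm_num

lemma toMz_ωO : toMz ωO = ωM := by ext <;> simp

lemma toMz_iO : toMz iO = iM := by ext <;> simp

lemma iM_sq : iM ^ 2 = -1 := by rw [← toMz_iO, ← map_pow, iO_sq, map_neg, map_one]

lemma star_iM : star iM = -iM := by rw [← toMz_iO, ← toMz_star, star_iO, map_neg]

lemma toMz_algebraMap (a : Zr) : toMz (algebraMap Zr Oz a) = algebraMap Fr Mz (toFr a) := by
  rw [← C_eq_algebraMap, ← C_eq_algebraMap]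
  ext1 <;> simp

lemma star_algebraMap_Mz (a : Fr) : star (algebraMap Fr Mz a) = algebraMap Fr Mz a := by
  rw [← C_eq_algebraMap]
  ext1 <;> simp

/-- The element `y + 4εi` of `ℚ(ζ₁₂)`, a factor of `y² + 16ε²`. -/
def eta (y : Fr) : Mz := algebraMap Fr Mz y + algebraMap Fr Mz (4 * ε) * iM

lemma star_eta (y : Fr) : star (eta y) = algebraMap Fr Mz y - algebraMap Fr Mz (4 * ε) * iM := by
  rw [eta, star_add, star_mul', star_iM, star_algebraMap_Mz, star_algebraMap_Mz]
  ring

lemma eta_mul_star (y : Fr) : eta y * star (eta y) = algebraMap Fr Mz (y ^ 2 + 16 * ε ^ 2) := by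
  rw [star_eta, eta, show y ^ 2 + 16 * ε ^ 2 = y ^ 2 + (4 * ε) ^ 2 by ring, map_add, map_pow, map_pow]
  linear_combination -algebraMap Fr Mz (4 * ε) ^ 2 * iM_sq

lemma isUnit_iO : IsUnit iO := IsUnit.of_mul_eq_one (-iO) (by linear_combination -iO_sq)

lemma isUnit_εZ : IsUnit εZ := IsUnit.of_mul_eq_one (star εZ) (by ext <;> simp)

/-- Elements of `ℚ(√3)` cubed, of the form `y² + 16ε²`, have `y + 4εi` a unit times a cube. -/
lemma eta_eq_unit_mul_cube {x y : Fr} (hx : x ≠ 0) (h : y ^ 2 + 16 * ε ^ 2 = x ^ 3) :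
    ∃ (U : Oz) (γ : Mz), IsUnit U ∧ eta y = toMz U * γ ^ 3 := by
  obtain ⟨a, c, hc, hac, hη⟩ := Mz_fraction (eta y)
  obtain ⟨b, d, hd, hbd, hxd⟩ := Fr_fraction x
  set B := algebraMap Zr Oz b with hB
  set D := algebraMap Zr Oz d with hD
  have hηη := eta_mul_star y
  rw [h, map_pow] at hηη
  have hη' : star (eta y) * star (toMz c) = toMz (star a) := by
    rw [toMz_star, ← hη, star_mul']
  have hxD : algebraMap Fr Mz x * toMz D = toMz B := by
    rw [hB, hD, toMz_algebraMap, toMz_algebraMap, ← hxd, map_mul]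
  have key : a * star a * D ^ 3 = B ^ 3 * (c * star c) := by
    apply toMz_injective
    simp only [map_mul, map_pow, ← hxD, ← hη, ← hη', ← toMz_star]
    linear_combination toMz c * toMz (star c) * toMz D ^ 3 * hηη
  have hsub : star (eta y) = eta y - toMz (8 * algebraMap Zr Oz εZ * iO) := by
    rw [star_eta, eta, map_mul toMz, map_mul toMz, toMz_iO, toMz_algebraMap, toFr_εZ, map_mul,
      map_ofNat, map_ofNat]
    ring
  have key2 : star a * c = (a - 8 * algebraMap Zr Oz εZ * iO * c) * star c := by
    apply toMz_injective
    simp only [map_mul, map_sub, ← hη, ← hη', ← toMz_star, hsub]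
    ring
  have hcc : c ∣ star c := by
    have h1 : IsCoprime c (a - 8 * algebraMap Zr Oz εZ * iO * c) := by
      rw [sub_eq_add_neg, ← neg_mul]
      exact hac.symm.add_mul_right_right _
    exact h1.dvd_of_dvd_mul_left ⟨star a, by rw [← key2, mul_comm]⟩
  have hcc' : star c ∣ c := by
    obtain ⟨z, hz⟩ := hcc
    exact ⟨star z, by rw [← star_mul', ← hz, star_star]⟩
  have hstar : ∀ {p q : Oz}, IsCoprime p q → IsCoprime (star p) (star q) := by
    rintro p q ⟨m, n, hmn⟩
    exact ⟨star m, star n, by rw [← star_mul', ← star_mul', ← star_add, hmn, star_one]⟩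
  have h1 : IsCoprime a (star c) := hac.of_isCoprime_of_dvd_right hcc'
  have h2 : IsCoprime (star a) (star c) := hstar hac
  have h3 : IsCoprime (star a) c := h2.of_isCoprime_of_dvd_right hcc
  have hac2 : IsCoprime a (c * star c) := hac.mul_right h1
  have hcop : IsCoprime (a * star a) (c * star c) := hac2.mul_left (h3.mul_right h2)
  have hBD : IsCoprime (B ^ 3) (D ^ 3) := (hbd.map (algebraMap Zr Oz)).pow
  have hassB : Associated (B ^ 3) (a * star a) := associated_of_dvd_dvd
    (hBD.dvd_of_dvd_mul_right ⟨_, key⟩) (hcop.dvd_of_dvd_mul_right ⟨_, key.symm⟩)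
  have hassD : Associated (D ^ 3) (c * star c) := associated_of_dvd_dvd
    (hBD.symm.dvd_of_dvd_mul_left ⟨a * star a, by rw [← key, mul_comm]⟩)
    (hcop.symm.dvd_of_dvd_mul_left ⟨B ^ 3, by rw [key, mul_comm]⟩)
  have hassc : Associated (c * star c) (c * c) :=
    (Associated.refl c).mul_mul (associated_of_dvd_dvd hcc' hcc)
  obtain ⟨v, hv⟩ := hassD.trans hassc
  have h8 : ∀ g, g ∣ a → g ∣ star a → g ∣ 8 := by
    intro g hg hg'
    have hgc : IsCoprime g (c * star c) := hac2.of_isCoprime_of_dvd_left hg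
    have h4 : g ∣ (8 * (algebraMap Zr Oz εZ * iO)) * (c * star c) := by
      rw [show 8 * (algebraMap Zr Oz εZ * iO) * (c * star c) = a * star c - star a * c by
        rw [key2]; ring]
      exact dvd_sub (hg.mul_right _) (hg'.mul_right _)
    have h5 := hgc.dvd_of_dvd_mul_right h4
    rwa [((isUnit_εZ.map (algebraMap Zr Oz)).mul isUnit_iO).dvd_mul_right] at h5
  have hc' : toMz c ≠ 0 := by rwa [Ne, map_eq_zero_iff _ toMz_injective]
  have ha : a ≠ 0 := by
    rintro rfl
    rw [map_zero, mul_eq_zero, or_iff_left hc'] at hη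
    rw [hη, zero_mul] at hηη
    have := hηη.symm
    simp [hx] at this
  obtain ⟨u, e, hu, hae⟩ := eq_unit_mul_cube_of_norm_associated ha hassB h8
  refine ⟨u * v, toMz e * toMz D / toMz c, hu.mul v.isUnit, ?_⟩
  have hv' : toMz D ^ 3 * toMz v = toMz c * toMz c := by
    rw [← map_pow, ← map_mul, hv, map_mul]
  apply mul_right_cancel₀ hc'
  rw [hη, hae]
  simp only [map_mul, map_pow]
  field_simp
  linear_combination -(toMz u * toMz e ^ 3) * hv'

lemma eta_eq_omega_mul_cube {x y : Fr} (hx : x ≠ 0) (h : y ^ 2 + 16 * ε ^ 2 = x ^ 3) :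
    ∃ k < 3, ∃ γ : Mz, eta y = ωM ^ k * γ ^ 3 := by
  obtain ⟨U, γ, hU, hη⟩ := eta_eq_unit_mul_cube hx h
  obtain ⟨U', hUU'⟩ := hU.exists_right_inv
  have hst : star U * star U' = 1 := by rw [← star_mul', hUU', star_one]
  obtain ⟨k, -, w, hw⟩ := exists_eq_omega_mul_cube (v := U * star U') (by
    rw [star_mul', star_star]
    linear_combination U * U' * hst + hUU')
  have hU2 : U ^ 4 = (U * star U) ^ 2 * (ωO ^ k * w ^ 3) ^ 2 := by
    rw [← hw]
    linear_combination -U ^ 4 * (star U * star U' + 1) * hst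
  have hηη := eta_mul_star y
  rw [h, map_pow] at hηη
  have hγ : γ * star γ ≠ 0 := by
    intro h0
    rw [hη, star_mul', star_pow] at hηη
    have h1 : algebraMap Fr Mz x ^ 3 = 0 := by
      rw [← hηη]
      linear_combination toMz U * star (toMz U) * (γ * star γ) ^ 2 * h0
    simp [hx] at h1
  have hN : toMz (U * star U) = (algebraMap Fr Mz x / (γ * star γ)) ^ 3 := by
    rw [map_mul, toMz_star, div_pow, eq_div_iff (pow_ne_zero _ hγ), ← hηη, hη, star_mul', star_pow]
    ring
  set n := algebraMap Fr Mz x / (γ * star γ) with hn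
  have hUne : toMz U ≠ 0 := (hU.map toMz).ne_zero
  have hU4 := congrArg toMz hU2
  rw [map_mul, map_pow toMz (U * star U), hN] at hU4
  simp only [map_mul, map_pow, toMz_ωO] at hU4
  refine ⟨(2 * k) % 3, Nat.mod_lt _ (by norm_num), n ^ 2 * toMz w ^ 2 * γ / toMz U, ?_⟩
  rw [hη, ← pow_eq_pow_mod (2 * k) ωM_cube]
  field_simp
  linear_combination γ ^ 3 * hU4

lemma Fr_sq_ne_neg_one (z : Fr) : z ^ 2 ≠ -1 := by
  intro h
  have h1 := congrArg re h
  simp [sq] at h1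
  nlinarith [sq_nonneg z.re, sq_nonneg z.im]

lemma Fr_cube_injective {x y : Fr} (h : x ^ 3 = y ^ 3) : x = y := by
  by_contra hne
  have h1 : x ^ 2 + x * y + y ^ 2 = 0 := by
    apply mul_left_cancel₀ (sub_ne_zero.2 hne)
    linear_combination h
  have h2 : (2 * x + y) ^ 2 = -(s * y) ^ 2 := by
    linear_combination 4 * h1 + y ^ 2 * s_sq
  have hy : s * y ≠ 0 := by
    intro h0
    rw [h0] at h2
    have hs : s ≠ 0 := by simp [QuadraticAlgebra.ext_iff]
    have hy := (mul_eq_zero.1 h0).resolve_left hs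
    subst hy
    apply hne
    simpa using h2
  apply Fr_sq_ne_neg_one ((2 * x + y) / (s * y))
  rw [div_pow, h2, neg_div, div_self (pow_ne_zero 2 hy)]

lemma Fr_cube_ne_of_norm {q : ℚ} (hq : ∀ r : ℚ, r ^ 3 ≠ q) {z : Fr} (hz : QuadraticAlgebra.norm z = q)
    (w : Fr) : w ^ 3 ≠ z := by
  rintro rfl
  exact hq _ (by rw [← hz, map_pow])

lemma Rat_cube_ne_256 (r : ℚ) : r ^ 3 ≠ 256 := by
  intro h
  have := congrArg (padicValRat 2) h
  rw [padicValRat.pow, show (256 : ℚ) = ((2 : ℕ) : ℚ) ^ 8 by norm_num,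
    padicValRat.pow, padicValRat.self (by norm_num)] at this
  omega

lemma ε_not_cube (w : Fr) : w ^ 3 ≠ ε := by
  intro h
  have hn : norm w = 1 := by
    have h1 : norm w ^ 3 = 1 ^ 3 := by
      rw [← map_pow, h]
      norm_num [norm_def]
    exact (show Odd 3 by decide).pow_injective h1
  have hre := congrArg re h
  rw [norm_def] at hn
  simp [pow_succ] at hre
  have h4 : 4 * w.re ^ 3 - 3 * w.re = 2 := by
    linear_combination hre + 3 * w.re * hn
  set t : ℚ := 2 * w.re with ht
  have h5 : t ^ 3 - 3 * t = 4 := by rw [ht]; linear_combination 2 * h4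
  have hden : (t.num : ℤ) ^ 3 = t.den * (3 * t.num * t.den + 4 * t.den ^ 2) := by
    have := Rat.num_div_den t
    have hd : (t.den : ℚ) ≠ 0 := by simp
    rw [← this] at h5
    field_simp at h5
    have h6 : (t.num : ℚ) ^ 3 = t.den * (3 * t.num * t.den + 4 * t.den ^ 2) := by
      linear_combination h5
    exact_mod_cast h6
  have hco : IsCoprime ((t.num : ℤ) ^ 3) t.den :=
    (Rat.isCoprime_num_den t).pow_left
  have hu : IsUnit (t.den : ℤ) := hco.symm.isUnit_of_dvd' dvd_rfl ⟨_, hden⟩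
  have hd1 : t.den = 1 := by simpa [Int.isUnit_iff_natAbs_eq] using hu
  rw [hd1] at hden
  have h7 : t.num * (t.num ^ 2 - 3) = 4 := by push_cast at hden; linear_combination hden
  generalize t.num = n at h7
  have : n ≤ 2 := by nlinarith [sq_nonneg n]
  have : -2 ≤ n := by nlinarith [sq_nonneg n]
  interval_cases n <;> omega

section Descent

variable {y₁ y₂ y₃ : Fr}

lemma cubes_of_eq {r A B C : Fr} (hsum : y₁ + y₂ + y₃ = 0) (hprod : y₁ * y₂ * y₃ = -ε)
    (h1 : y₁ = r * A ^ 3) (h2 : y₂ = r * B ^ 3) (h3 : y₃ = r * (ε * C ^ 3)) :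
    ∃ A B C : Fr, A * B * C ≠ 0 ∧ A ^ 3 + B ^ 3 + ε * C ^ 3 = 0 ∧
      (y₁ ^ 2 + y₂ ^ 2 + y₃ ^ 2) * (A * B * C) ^ 2 = A ^ 6 + B ^ 6 + ε ^ 2 * C ^ 6 := by
  have hr : r * (A * B * C) = -1 := by
    apply Fr_cube_injective
    apply mul_left_cancel₀ ε_ne_zero
    rw [h1, h2, h3] at hprod
    linear_combination hprod
  have hr0 : r ≠ 0 := by
    rintro rfl
    simp at hr
  refine ⟨A, B, C, ?_, ?_, ?_⟩
  · intro h
    simp [h] at hr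
  · apply mul_left_cancel₀ hr0
    rw [h1, h2, h3] at hsum
    linear_combination hsum
  · rw [h1, h2, h3]
    linear_combination (A ^ 6 + B ^ 6 + ε ^ 2 * C ^ 6) * (r * (A * B * C) - 1) * hr

lemma exists_eq_pow_mul_cubes (hsum : y₁ + y₂ + y₃ = 0) (hprod : y₁ * y₂ * y₃ = -ε) :
    ∃ (r c₁ c₂ c₃ : Fr) (j₁ j₂ j₃ : ℕ), j₁ < 3 ∧ j₂ < 3 ∧ j₃ < 3 ∧ y₁ = r * (ε ^ j₁ * c₁ ^ 3) ∧
      y₂ = r * (ε ^ j₂ * c₂ ^ 3) ∧ y₃ = r * (ε ^ j₃ * c₃ ^ 3) := by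
  have hy2 : y₂ ≠ 0 := by
    rintro rfl
    rw [mul_zero, zero_mul] at hprod
    exact ε_ne_zero (neg_eq_zero.1 hprod.symm)
  obtain ⟨e₁, e₂, he2, hco, hfr⟩ := Fr_fraction (y₁ / y₂)
  have he2' : toFr e₂ ≠ 0 := by rwa [Ne, map_eq_zero_iff _ toFr_injective]
  set r := y₂ / toFr e₂ with hr
  have h2 : y₂ = r * toFr e₂ := by rw [hr]; field_simp
  have h1 : y₁ = r * toFr e₁ := by rw [← hfr, hr]; field_simp
  set e₃ := -e₁ - e₂ with he3
  have h3 : y₃ = r * toFr e₃ := by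
    rw [he3, map_sub, map_neg]
    linear_combination hsum - h1 - h2
  obtain ⟨p, q, hq, hpq, hpr⟩ := Fr_fraction r
  have key : e₁ * e₂ * e₃ * p ^ 3 = -εZ * q ^ 3 := by
    apply toFr_injective
    rw [h1, h2, h3] at hprod
    simp only [map_mul, map_pow, map_neg, toFr_εZ, ← hpr]
    linear_combination toFr q ^ 3 * hprod
  have hass : Associated (q ^ 3) (e₁ * e₂ * e₃) := by
    refine associated_of_dvd_dvd ((hpq.symm.pow (m := 3) (n := 3)).dvd_of_dvd_mul_right
      ⟨-εZ, by rw [key, mul_comm]⟩) ?_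
    rw [← isUnit_εZ.neg.dvd_mul_left, ← key]
    exact dvd_mul_right _ _
  have h13 : IsCoprime e₁ e₃ := by
    rw [he3, sub_eq_add_neg, add_comm, neg_eq_neg_one_mul e₁, mul_comm]
    exact (IsCoprime.neg_right hco).add_mul_left_right _
  have h23 : IsCoprime e₂ e₃ := by
    rw [he3, sub_eq_add_neg, neg_eq_neg_one_mul e₂, mul_comm]
    exact (IsCoprime.neg_right hco.symm).add_mul_left_right _
  have hform : ∀ e d : Zr, Associated (d ^ 3) e → ∃ j < 3, ∃ c : Fr, toFr e = ε ^ j * c ^ 3 := by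
    rintro _ d ⟨u, rfl⟩
    obtain ⟨j, hj, w, -, hw⟩ := Zr_unit_cube u u.isUnit
    refine ⟨j, hj, toFr d * toFr w, ?_⟩
    rw [hw]
    simp only [map_mul, map_pow, toFr_εZ]
    ring
  obtain ⟨d₁, hd1⟩ := exists_associated_pow_of_associated_pow_mul (hco.mul_right h13)
    (by rwa [← mul_assoc])
  obtain ⟨d₂, hd2⟩ := exists_associated_pow_of_associated_pow_mul (hco.symm.mul_right h23)
    (c := q) (k := 3) (by rwa [mul_left_comm, ← mul_assoc])
  obtain ⟨d₃, hd3⟩ := exists_associated_pow_of_associated_pow_mul (h13.symm.mul_right h23.symm)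
    (c := q) (k := 3) (by rwa [mul_comm])
  obtain ⟨j₁, hj1, c₁, hc1⟩ := hform _ _ hd1
  obtain ⟨j₂, hj2, c₂, hc2⟩ := hform _ _ hd2
  obtain ⟨j₃, hj3, c₃, hc3⟩ := hform _ _ hd3
  exact ⟨r, c₁, c₂, c₃, j₁, j₂, j₃, hj1, hj2, hj3, hc1 ▸ h1, hc2 ▸ h2, hc3 ▸ h3⟩

lemma exists_cubes (hsum : y₁ + y₂ + y₃ = 0) (hprod : y₁ * y₂ * y₃ = -ε) :
    ∃ A B C : Fr, A * B * C ≠ 0 ∧ A ^ 3 + B ^ 3 + ε * C ^ 3 = 0 ∧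
      (y₁ ^ 2 + y₂ ^ 2 + y₃ ^ 2) * (A * B * C) ^ 2 = A ^ 6 + B ^ 6 + ε ^ 2 * C ^ 6 := by
  obtain ⟨r, c₁, c₂, c₃, j₁, j₂, j₃, hj1, hj2, hj3, h1, h2, h3⟩ :=
    exists_eq_pow_mul_cubes hsum hprod
  have hp : (r * (c₁ * c₂ * c₃)) ^ 3 * ε ^ (j₁ + j₂ + j₃) = -ε := by
    rw [← hprod, h1, h2, h3]
    ring
  have hε := ε_ne_zero
  have hmod : (j₁ + j₂ + j₃) % 3 = 1 := by
    generalize j₁ + j₂ + j₃ = n at hp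
    rw [← Nat.div_add_mod n 3, pow_add, pow_mul'] at hp
    have h3 : n % 3 < 3 := Nat.mod_lt _ (by norm_num)
    generalize r * (c₁ * c₂ * c₃) = z at hp
    generalize ε ^ (n / 3) = g at hp
    interval_cases n % 3
    · exact absurd (show (-(z * g)) ^ 3 = ε by linear_combination -hp) (ε_not_cube _)
    · rfl
    · have h1 : (-(z * g)) ^ 3 * ε = 1 := by
        apply mul_left_cancel₀ hε
        linear_combination -hp
      refine absurd (show (1 / (-(z * g))) ^ 3 = ε from ?_) (ε_not_cube _)
      rw [div_pow, one_pow, div_eq_iff]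
      · linear_combination -h1
      · intro h0
        simp [h0] at h1
  have h12 : y₂ + y₁ + y₃ = 0 := by linear_combination hsum
  have p1 : y₃ * y₂ * y₁ = -ε := by linear_combination hprod
  have s1 : y₃ + y₂ + y₁ = 0 := by linear_combination hsum
  have p2 : y₁ * y₃ * y₂ = -ε := by linear_combination hprod
  have s2 : y₁ + y₃ + y₂ = 0 := by linear_combination hsum
  have e1 : y₁ ^ 2 + y₂ ^ 2 + y₃ ^ 2 = y₃ ^ 2 + y₂ ^ 2 + y₁ ^ 2 := by ring
  have e2 : y₁ ^ 2 + y₂ ^ 2 + y₃ ^ 2 = y₁ ^ 2 + y₃ ^ 2 + y₂ ^ 2 := by ring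
  interval_cases j₁ <;> interval_cases j₂ <;> interval_cases j₃ <;> first | omega | skip
  · exact cubes_of_eq hsum hprod (r := r) (A := c₁) (B := c₂) (C := c₃) (by rw [h1]; ring)
      (by rw [h2]; ring) (by rw [h3]; ring)
  · rw [e2]
    exact cubes_of_eq s2 p2 (r := r) (A := c₁) (B := c₃) (C := c₂) (by rw [h1]; ring)
      (by rw [h3]; ring) (by rw [h2]; ring)
  · rw [e1]
    exact cubes_of_eq s1 p1 (r := r * ε ^ 2) (A := c₃) (B := c₂) (C := c₁ / ε) (by rw [h3]; ring)
      (by rw [h2]; ring) (by rw [h1]; field_simp)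
  · rw [e1]
    exact cubes_of_eq s1 p1 (r := r) (A := c₃) (B := c₂) (C := c₁) (by rw [h3]; ring)
      (by rw [h2]; ring) (by rw [h1]; ring)
  · exact cubes_of_eq hsum hprod (r := r * ε) (A := c₁) (B := c₂) (C := c₃) (by rw [h1]; ring)
      (by rw [h2]; ring) (by rw [h3]; ring)
  · rw [e2]
    exact cubes_of_eq s2 p2 (r := r * ε) (A := c₁) (B := c₃) (C := c₂) (by rw [h1]; ring)
      (by rw [h3]; ring) (by rw [h2]; ring)
  · rw [e2]
    exact cubes_of_eq s2 p2 (r := r * ε ^ 2) (A := c₁) (B := c₃) (C := c₂ / ε) (by rw [h1]; ring)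
      (by rw [h3]; ring) (by rw [h2]; field_simp)
  · rw [e1]
    exact cubes_of_eq s1 p1 (r := r * ε) (A := c₃) (B := c₂) (C := c₁) (by rw [h3]; ring)
      (by rw [h2]; ring) (by rw [h1]; ring)
  · exact cubes_of_eq hsum hprod (r := r * ε ^ 2) (A := c₁) (B := c₂) (C := c₃ / ε)
      (by rw [h1]; ring) (by rw [h2]; ring) (by rw [h3]; field_simp)

end Descent

/-- The constant term of the curve `y² = x³ - 16ε²`. -/
abbrev κ : Fr := -(16 * ε ^ 2)

lemma κ_ne_zero : κ ≠ 0 := neg_ne_zero.2 (mul_ne_zero (by norm_num) (pow_ne_zero _ ε_ne_zero))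

lemma four_mul_ε_ne_zero : 4 * ε ≠ 0 := mul_ne_zero (by norm_num) ε_ne_zero

lemma x_ne_zero {x y : Fr} (h : y ^ 2 = x ^ 3 + κ) : x ≠ 0 := by
  rintro rfl
  apply Fr_sq_ne_neg_one (y / (4 * ε))
  rw [div_pow, h, div_eq_iff (pow_ne_zero _ four_mul_ε_ne_zero)]
  ring

lemma y_ne_zero {x y : Fr} (h : y ^ 2 = x ^ 3 + κ) : y ≠ 0 := by
  rintro rfl
  refine Fr_cube_ne_of_norm Rat_cube_ne_256 (z := 16 * ε ^ 2) ?_ x (by linear_combination -h)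
  norm_num [norm_def, sq]

lemma tripling_ne_zero {x : Fr} : x ^ 3 + 4 * κ ≠ 0 := by
  intro h
  apply ε_not_cube (4 * ε / x)
  have hx : x ≠ 0 := by
    rintro rfl
    have := four_mul_ε_ne_zero
    apply pow_ne_zero 2 this
    linear_combination -(1 / 4) * h
  rw [div_pow, div_eq_iff (pow_ne_zero _ hx)]
  linear_combination -ε * h

lemma triple_of_cubes {A B C x y : Fr} (hABC : A * B * C ≠ 0) (h0 : A ^ 3 + B ^ 3 + ε * C ^ 3 = 0)
    {D : (mordell κ).Point} (hD : IsAt D x y)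
    (hx : 3 * x * (A * B * C) ^ 2 = 2 * (A ^ 6 + B ^ 6 + ε ^ 2 * C ^ 6)) : ∃ D₁, D = (3 : ℕ) • D₁ := by
  have hC : C ≠ 0 := right_ne_zero_of_mul hABC
  have hA : A ≠ 0 := left_ne_zero_of_mul (left_ne_zero_of_mul hABC)
  have hB : B ≠ 0 := right_ne_zero_of_mul (left_ne_zero_of_mul hABC)
  have hε := ε_ne_zero
  have hAB : A + B ≠ 0 := by
    intro h
    have : ε * C ^ 3 = 0 := by linear_combination h0 - (A ^ 2 - A * B + B ^ 2) * h
    exact mul_ne_zero hε (pow_ne_zero _ hC) this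
  have hε3 : ε * C ^ 3 = -(A ^ 3 + B ^ 3) := by linear_combination h0
  set X := -4 * ε * C / (A + B) with hX
  set Y := 4 * s * ε * (A - B) / (A + B) with hY
  have hX3 : X ^ 3 = 64 * ε ^ 2 * (A ^ 2 - A * B + B ^ 2) / (A + B) ^ 2 := by
    rw [hX, div_pow]
    field_simp
    linear_combination -64 * h0
  have hXY : Y ^ 2 = X ^ 3 + κ := by
    rw [hX3, hY, κ]
    field_simp
    linear_combination 16 * (A - B) ^ 2 * s_sq
  have hX0 := x_ne_zero hXY
  have hXC : X * C ^ 2 = 4 * (A ^ 2 - A * B + B ^ 2) := by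
    rw [hX]
    field_simp
    linear_combination -h0
  obtain ⟨D₁, hD1⟩ := exists_isAt κ_ne_zero hXY
  have h3 := hD1.triple hX0 (y_ne_zero hXY) tripling_ne_zero
  have hxx : (X ^ 9 - 96 * κ * X ^ 6 + 48 * κ ^ 2 * X ^ 3 + 64 * κ ^ 3)
      / (9 * X ^ 2 * (X ^ 3 + 4 * κ) ^ 2) = x := by
    have h4 := @tripling_ne_zero X
    have e1 : X ^ 3 + 4 * κ = -192 * ε ^ 2 * (A * B) / (A + B) ^ 2 := by
      rw [hX3, κ]
      field_simp
      ring
    have hx' : 3 * x * (A * B * C) ^ 2 = 4 * (A ^ 6 + A ^ 3 * B ^ 3 + B ^ 6) := by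
      linear_combination hx + 2 * (ε * C ^ 3 - (A ^ 3 + B ^ 3)) * hε3
    have e2 : ((X ^ 3) ^ 3 - 96 * κ * (X ^ 3) ^ 2 + 48 * κ ^ 2 * X ^ 3 + 64 * κ ^ 3)
        * (4 * (A ^ 2 - A * B + B ^ 2) * (A * B) ^ 2)
        = 4 * (A ^ 6 + A ^ 3 * B ^ 3 + B ^ 6) * (3 * X ^ 3 * (X ^ 3 + 4 * κ) ^ 2) := by
      rw [e1, hX3, κ]
      field_simp
      ring
    rw [div_eq_iff (mul_ne_zero (mul_ne_zero (by norm_num) (pow_ne_zero _ hX0))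
      (pow_ne_zero _ h4))]
    apply mul_right_cancel₀ (mul_ne_zero hX0 (pow_ne_zero 2 hABC))
    linear_combination e2 + ((X ^ 3) ^ 3 - 96 * κ * (X ^ 3) ^ 2 + 48 * κ ^ 2 * X ^ 3 + 64 * κ ^ 3)
      * (A * B) ^ 2 * hXC - 3 * X ^ 3 * (X ^ 3 + 4 * κ) ^ 2 * hx'
  rw [hxx] at h3
  rcases hD.eq_or_eq_neg h3 with h | h
  · exact ⟨D₁, h⟩
  · exact ⟨-D₁, by rw [h, neg_nsmul]⟩

lemma exists_triple_of_eta_eq_cube {x y : Fr} {D : (mordell κ).Point} (hD : IsAt D x y) {γ : Mz}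
    (h : eta y = γ ^ 3) : ∃ D₁, D = (3 : ℕ) • D₁ := by
  set a := γ.re + s * γ.im / 2 with ha
  set b := γ.im / 2 with hb
  have hγ : γ = algebraMap Fr Mz a + algebraMap Fr Mz b * iM := by
    rw [← C_eq_algebraMap]
    apply QuadraticAlgebra.ext
    · simp only [re_add, re_mul, re_C, im_C, ha, hb]
      ring
    · simp only [im_add, im_mul, re_C, im_C, hb]
      ring
  have h1 : eta y = algebraMap Fr Mz (a ^ 3 - 3 * a * b ^ 2)
      + algebraMap Fr Mz (3 * a ^ 2 * b - b ^ 3) * iM := by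
    rw [h, hγ]
    simp only [map_sub, map_mul, map_pow, map_ofNat]
    linear_combination (3 * algebraMap Fr Mz a * algebraMap Fr Mz b ^ 2
      + algebraMap Fr Mz b ^ 3 * iM) * iM_sq
  have him : 4 * ε = 3 * a ^ 2 * b - b ^ 3 := by
    have := congrArg im h1
    rw [eta, ← C_eq_algebraMap] at this
    simp only [im_add, im_mul, im_C, re_C] at this
    apply mul_right_cancel₀ (two_ne_zero (α := Fr))
    linear_combination this
  have hre : y = a ^ 3 - 3 * a * b ^ 2 := by
    have := congrArg re h1
    rw [eta, ← C_eq_algebraMap] at this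
    simp only [re_add, re_mul, im_C, re_C] at this
    linear_combination this + s * him
  have hx : x = a ^ 2 + b ^ 2 := by
    apply Fr_cube_injective
    have := hD.equation
    rw [κ] at this
    linear_combination -this + (y + (a ^ 3 - 3 * a * b ^ 2)) * hre
      + (4 * ε + (3 * a ^ 2 * b - b ^ 3)) * him
  obtain ⟨A, B, C, hABC, h0, h6⟩ := exists_cubes (y₁ := (s * a - b) / 2) (y₂ := -(s * a + b) / 2)
    (y₃ := b) (by ring) (by linear_combination (1 / 4) * him - b * a ^ 2 / 4 * s_sq)
  refine triple_of_cubes hABC h0 hD ?_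
  rw [hx]
  linear_combination 2 * h6 - a ^ 2 * (A * B * C) ^ 2 * s_sq

lemma eta_ne_zero (y : Fr) : eta y ≠ 0 := by
  intro h
  have := congrArg im h
  rw [eta, ← C_eq_algebraMap] at this
  simp only [im_add, im_mul, im_C, re_C, im_zero] at this
  apply four_mul_ε_ne_zero
  linear_combination (1 / 2) * this

lemma eta_neg (y : Fr) : eta (-y) = -star (eta y) := by
  rw [star_eta, eta, map_neg]
  ring

/-- Multiplicativity of `eta`, modulo cubes, along a line through three points of the curve. -/
lemma eta_eq_mul_cube {x₁ y₁ x₂ y₂ l x₃ y₃ : Fr} (h₁ : y₁ ^ 2 = x₁ ^ 3 + κ)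
    (h₂ : y₂ ^ 2 = x₂ ^ 3 + κ) (hx : x₁ ≠ x₂) (hl : l * (x₁ - x₂) = y₁ - y₂)
    (hx₃ : x₃ = l ^ 2 - x₁ - x₂) (hy₃ : y₃ = -(l * (x₃ - x₁) + y₁)) (h₃ : y₃ ^ 2 = x₃ ^ 3 + κ) :
    ∃ γ, eta y₃ = eta y₁ * eta y₂ * γ ^ 3 := by
  set c := y₁ - l * x₁ with hc
  have hy1 : y₁ = l * x₁ + c := by rw [hc]; ring
  have hy2 : y₂ = l * x₂ + c := by rw [hc]; linear_combination hl
  have hy3 : y₃ = -(l * x₃ + c) := by rw [hy₃, hc]; ring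
  -- the elementary symmetric functions of the roots of `X ^ 3 + κ - (l * X + c) ^ 2`
  have e2 : x₁ * x₂ + x₁ * x₃ + x₂ * x₃ = -2 * l * c := by
    apply mul_left_cancel₀ (sub_ne_zero.2 hx)
    rw [hy1] at h₁
    rw [hy2] at h₂
    rw [hx₃]
    linear_combination h₁ - h₂
  have e3 : x₁ * x₂ * x₃ = c ^ 2 - κ := by
    rw [hy1] at h₁
    rw [hx₃] at e2 ⊢
    linear_combination x₁ * e2 - h₁
  have hfac : eta y₁ * eta y₂ * -star (eta y₃) = eta c ^ 3 := by
    rw [star_eta, eta, eta, eta, hy1, hy2, hy3]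
    have e1' := congrArg (algebraMap Fr Mz) hx₃
    have e2' := congrArg (algebraMap Fr Mz) e2
    have e3' := congrArg (algebraMap Fr Mz) e3
    simp only [map_mul, map_add, map_sub, map_pow, map_neg, map_ofNat] at e1' e2' e3' ⊢
    generalize algebraMap Fr Mz ε = ε' at *
    generalize algebraMap Fr Mz l = l' at *
    generalize algebraMap Fr Mz c = c' at *
    generalize algebraMap Fr Mz x₁ = x₁' at *
    generalize algebraMap Fr Mz x₂ = x₂' at *
    generalize algebraMap Fr Mz x₃ = x₃' at *
    linear_combination l' ^ 3 * e3' + l' ^ 2 * (c' + 4 * ε' * iM) * e2'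
      + l' * (c' + 4 * ε' * iM) ^ 2 * e1' + 16 * ε' ^ 2 * l' ^ 3 * iM_sq
  have hc0 := eta_ne_zero c
  have hx3 := x_ne_zero h₃
  have hx3' : algebraMap Fr Mz x₃ ≠ 0 := by simpa using hx3
  have hs : eta y₃ * star (eta y₃) = algebraMap Fr Mz x₃ ^ 3 := by
    rw [eta_mul_star, h₃, κ, ← map_pow]
    congr 1
    ring
  refine ⟨-(algebraMap Fr Mz x₃ / eta c), ?_⟩
  apply mul_right_cancel₀ (pow_ne_zero 3 hc0)
  field_simp
  linear_combination -eta y₃ * hfac - eta y₁ * eta y₂ * hs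

lemma eta_neg_base : eta (-(4 * ε ^ 2)) = ωM * (iM * (1 + iM) * (1 + algebraMap Fr Mz s)) ^ 3 := by
  rw [eta, ← C_eq_algebraMap]
  ext <;> simp [pow_succ] <;> norm_num

lemma base_equation : (-(4 * ε ^ 2)) ^ 2 = (4 * ε) ^ 3 + κ := by
  rw [κ]
  linear_combination 16 * ε ^ 2 * ε_sq

/-- A point of the curve, generating its Mordell-Weil group modulo triples. -/
noncomputable def base : (mordell κ).Point := (exists_isAt κ_ne_zero base_equation).choose

lemma isAt_base : IsAt base (4 * ε) (-(4 * ε ^ 2)) :=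
  (exists_isAt κ_ne_zero base_equation).choose_spec

lemma exists_of_eta_eq_omega {x y : Fr} {D : (mordell κ).Point} (hD : IsAt D x y) {γ : Mz}
    (h : eta y = ωM * γ ^ 3) : ∃ D₁, D = (3 : ℕ) • D₁ ∨ D = base + (3 : ℕ) • D₁ ∨
      D = -base + (3 : ℕ) • D₁ := by
  by_cases hx : x = 4 * ε
  · subst hx
    refine ⟨0, Or.inr ?_⟩
    simpa using hD.eq_or_eq_neg isAt_base
  · have hN := isAt_base.neg
    have hadd := hD.add hN hx (div_mul_cancel₀ _ (sub_ne_zero.2 hx)) rfl rfl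
    obtain ⟨γ', hγ'⟩ := eta_eq_mul_cube hD.equation hN.equation hx
      (div_mul_cancel₀ _ (sub_ne_zero.2 hx)) rfl rfl hadd.equation
    rw [h, eta_neg (-(4 * ε ^ 2)), eta_neg_base] at hγ'
    have hω : ωM * star ωM = 1 := by ext <;> simp <;> norm_num
    obtain ⟨D₁, hD₁⟩ := exists_triple_of_eta_eq_cube hadd
      (γ := -γ * star (iM * (1 + iM) * (1 + algebraMap Fr Mz s)) * γ') (by
        rw [hγ', star_mul', star_pow]
        linear_combination -γ ^ 3 * star (iM * (1 + iM) * (1 + algebraMap Fr Mz s)) ^ 3 * γ' ^ 3 * hω)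
    exact ⟨D₁, Or.inr (Or.inl (by rw [← hD₁]; abel))⟩

/-- Descent: the point `base` generates the curve modulo triples. -/
theorem exists_eq_base_add_triple (D : (mordell κ).Point) :
    ∃ D₁, D = (3 : ℕ) • D₁ ∨ D = base + (3 : ℕ) • D₁ ∨ D = -base + (3 : ℕ) • D₁ := by
  rcases eq_zero_or_isAt D with rfl | ⟨x, y, hD⟩
  · exact ⟨0, Or.inl (by simp)⟩
  obtain ⟨k, hk, γ, hγ⟩ := eta_eq_omega_mul_cube (x_ne_zero hD.equation) (y := y) (by
    rw [hD.equation, κ]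
    ring)
  interval_cases k
  · obtain ⟨D₁, h⟩ := exists_triple_of_eta_eq_cube hD (γ := γ) (by rw [hγ]; ring)
    exact ⟨D₁, Or.inl h⟩
  · exact exists_of_eta_eq_omega hD (γ := γ) (by rw [hγ]; ring)
  · have hω : star ωM ^ 2 = ωM := by ext <;> simp [sq] <;> norm_num
    obtain ⟨D₁, h⟩ := exists_of_eta_eq_omega hD.neg (γ := -star γ) (by
      rw [eta_neg, hγ, star_mul', star_pow, star_pow, hω]
      ring)
    refine ⟨-D₁, ?_⟩
    rw [neg_nsmul]
    rcases h with h | h | h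
    · exact Or.inl (by rw [← h, neg_neg])
    · exact Or.inr (Or.inr (by rw [← neg_neg D, h]; abel))
    · exact Or.inr (Or.inl (by rw [← neg_neg D, h]; abel))

/-- The absolute value of `ℚ(√3)` at the prime `√3`, normalized by `ν 3 = 1 / 9`. -/
def ν (r : Fr) : ℚ := padicNorm 3 (QuadraticAlgebra.norm r)

lemma ν_zero : ν 0 = 0 := by simp [ν]

lemma ν_one : ν 1 = 1 := by simp [ν]

lemma ν_mul (a b : Fr) : ν (a * b) = ν a * ν b := by simp [ν, padicNorm.mul]

lemma ν_neg (a : Fr) : ν (-a) = ν a := by simp [ν]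

lemma ν_nonneg (a : Fr) : 0 ≤ ν a := padicNorm.nonneg _

lemma ν_eq_zero {a : Fr} : ν a = 0 ↔ a = 0 := by
  refine ⟨fun h => norm_eq_zero_iff_eq_zero.1 (padicNorm.zero_of_padicNorm_eq_zero h), ?_⟩
  rintro rfl
  exact ν_zero

lemma ν_pos {a : Fr} (h : a ≠ 0) : 0 < ν a := (ν_nonneg a).lt_of_ne' (mt ν_eq_zero.1 h)

lemma ν_pow (a : Fr) (n : ℕ) : ν (a ^ n) = ν a ^ n := by
  induction n with
  | zero => simp [ν_one]
  | succ n ih => rw [pow_succ, ν_mul, ih, pow_succ]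

lemma ν_div (a b : Fr) : ν (a / b) = ν a / ν b := by
  by_cases hb : b = 0
  · simp [hb, ν_zero]
  · rw [eq_div_iff (mt ν_eq_zero.1 hb), ← ν_mul, div_mul_cancel₀ _ hb]

lemma padicNorm_three : padicNorm 3 (3 : ℚ) = 1 / 3 := by
  have := padicNorm.padicNorm_p_of_prime (p := 3)
  norm_num at this
  simpa using this

lemma ν_eq_max (r : Fr) : ν r = max (padicNorm 3 r.re ^ 2) (padicNorm 3 r.im ^ 2 / 3) := by
  have h1 : QuadraticAlgebra.norm r = r.re ^ 2 + -(3 * r.im ^ 2) := by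
    rw [norm_def]
    ring
  have hsq : ∀ q : ℚ, padicNorm 3 (q ^ 2) = padicNorm 3 q ^ 2 := fun q => by
    rw [sq, padicNorm.mul, sq]
  have h3 : padicNorm 3 (-(3 * r.im ^ 2)) = padicNorm 3 r.im ^ 2 / 3 := by
    rw [padicNorm.neg, padicNorm.mul, padicNorm_three, hsq]
    ring
  rw [ν, h1, ← h3, ← hsq]
  by_cases hne : padicNorm 3 (r.re ^ 2) = padicNorm 3 (-(3 * r.im ^ 2))
  · have : r.re = 0 ∧ r.im = 0 := by
      by_contra hcon
      have hre : r.re ≠ 0 := by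
        intro h0
        rw [h0, h3, hsq, padicNorm.zero] at hne
        have : padicNorm 3 r.im ^ 2 = 0 := by linarith
        exact hcon ⟨h0, padicNorm.zero_of_padicNorm_eq_zero (pow_eq_zero_iff two_ne_zero |>.1 this)⟩
      have him : r.im ≠ 0 := by
        intro h0
        rw [h3, h0, hsq, padicNorm.zero] at hne
        have : padicNorm 3 r.re ^ 2 = 0 := by linarith
        exact hcon ⟨padicNorm.zero_of_padicNorm_eq_zero (pow_eq_zero_iff two_ne_zero |>.1 this), h0⟩
      have h4 : padicValRat 3 (r.re ^ 2) = padicValRat 3 (3 * r.im ^ 2) := by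
        rw [padicNorm.neg, padicNorm.eq_zpow_of_nonzero (pow_ne_zero _ hre),
          padicNorm.eq_zpow_of_nonzero (mul_ne_zero three_ne_zero (pow_ne_zero _ him))] at hne
        have := zpow_right_injective₀ (a := ((3 : ℕ) : ℚ)) (by norm_num) (by norm_num) hne
        linarith
      have h5 : padicValRat 3 3 = 1 := by
        exact_mod_cast padicValRat.self (p := 3) (by norm_num)
      rw [padicValRat.mul three_ne_zero (pow_ne_zero _ him), padicValRat.pow, padicValRat.pow,
        h5] at h4
      push_cast at h4
      omega
    rw [this.1, this.2]
    simp
  · exact padicNorm.add_eq_max_of_ne hne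

lemma ν_add_le_max (a b : Fr) : ν (a + b) ≤ max (ν a) (ν b) := by
  rw [ν_eq_max, ν_eq_max a, ν_eq_max b, re_add, im_add]
  have hsq : ∀ p q : ℚ, padicNorm 3 (p + q) ^ 2 ≤ max (padicNorm 3 p ^ 2) (padicNorm 3 q ^ 2) := by
    intro p q
    rcases le_max_iff.1 (padicNorm.nonarchimedean (p := 3) (q := p) (r := q)) with h | h
    · exact le_max_of_le_left (pow_le_pow_left₀ (padicNorm.nonneg _) h 2)
    · exact le_max_of_le_right (pow_le_pow_left₀ (padicNorm.nonneg _) h 2)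
  apply max_le
  · rcases le_max_iff.1 (hsq a.re b.re) with h | h
    · exact le_max_of_le_left (le_max_of_le_left h)
    · exact le_max_of_le_right (le_max_of_le_left h)
  · rcases le_max_iff.1 (hsq a.im b.im) with h | h
    · exact le_max_of_le_left (le_max_of_le_right (by linarith))
    · exact le_max_of_le_right (le_max_of_le_right (by linarith))

lemma ν_add_le {a b : Fr} {c : ℚ} (ha : ν a ≤ c) (hb : ν b ≤ c) : ν (a + b) ≤ c :=
  (ν_add_le_max a b).trans (max_le ha hb)

lemma ν_sub_le {a b : Fr} {c : ℚ} (ha : ν a ≤ c) (hb : ν b ≤ c) : ν (a - b) ≤ c := by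
  rw [sub_eq_add_neg]
  exact ν_add_le ha (by rwa [ν_neg])

lemma ν_eq_of_sub_lt {a b : Fr} (h : ν (a - b) < ν b) : ν a = ν b := by
  apply le_antisymm
  · rw [← sub_add_cancel a b]
    exact ν_add_le h.le le_rfl
  · by_contra! hlt
    have : ν b ≤ max (ν a) (ν (a - b)) := by
      conv_lhs => rw [← sub_sub_cancel a b]
      exact ν_sub_le (le_max_left _ _) (le_max_right _ _)
    exact absurd this (not_le.2 (max_lt hlt h))

lemma ν_eq_one_of_sub_one {a : Fr} (h : ν (a - 1) < 1) : ν a = 1 := by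
  rw [← ν_one] at h ⊢
  exact ν_eq_of_sub_lt h

/-- The valuation ring of `ν`. -/
def 𝒪 : Subring Fr where
  carrier := {r | ν r ≤ 1}
  mul_mem' := fun {a b} ha hb => by
    rw [Set.mem_ofPred_eq, ν_mul]
    exact mul_le_one₀ ha (ν_nonneg b) hb
  one_mem' := ν_one.le
  add_mem' := ν_add_le
  zero_mem' := by simp [ν_zero]
  neg_mem' := fun {a} ha => by rwa [Set.mem_ofPred_eq, ν_neg]

lemma ν_three : ν 3 = 1 / 9 := by
  have hre : (3 : Fr).re = 3 := rfl
  have him : (3 : Fr).im = 0 := rfl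
  rw [ν_eq_max, hre, him, padicNorm_three, padicNorm.zero]
  norm_num

lemma ν_s : ν s = 1 / 3 := by
  rw [ν_eq_max]
  simp

lemma ν_two : ν 2 = 1 := by
  rw [← ν_neg]
  apply ν_eq_one_of_sub_one
  rw [show (-2 - 1 : Fr) = -3 by ring, ν_neg, ν_three]
  norm_num

lemma ν_ε : ν ε = 1 := by
  have : QuadraticAlgebra.norm ε = 1 := by norm_num [norm_def]
  rw [ν, this, padicNorm.one]

lemma ν_four : ν 4 = 1 := by
  rw [show (4 : Fr) = 2 ^ 2 by norm_num, ν_pow, ν_two, one_pow]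

lemma ν_κ : ν κ = 1 := by
  rw [κ, ν_neg, ν_mul, ν_pow, ν_ε, show (16 : Fr) = 2 ^ 4 by norm_num, ν_pow, ν_two]
  norm_num

lemma mem_𝒪 {a : Fr} : a ∈ 𝒪 ↔ ν a ≤ 1 := Iff.rfl

lemma κ_mem : κ ∈ 𝒪 := ν_κ.le

lemma ν_three_mul_le {a : Fr} (h : a ∈ 𝒪) : ν (3 * a) ≤ 1 / 9 := by
  rw [ν_mul, ν_three]
  linarith [mem_𝒪.1 h]

lemma ν_le_third {a : Fr} (h : ν a < 1) : ν a ≤ 1 / 3 := by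
  rcases eq_or_ne a 0 with rfl | ha
  · rw [ν_zero]
    norm_num
  · have hn : QuadraticAlgebra.norm a ≠ 0 := mt norm_eq_zero_iff_eq_zero.1 ha
    rw [ν, padicNorm.eq_zpow_of_nonzero hn] at h ⊢
    have h1 : ((3 : ℕ) : ℚ) ^ (-padicValRat 3 (QuadraticAlgebra.norm a)) < ((3 : ℕ) : ℚ) ^ (0 : ℤ) := by
      simpa using h
    rw [zpow_lt_zpow_iff_right₀ (by norm_num)] at h1
    calc ((3 : ℕ) : ℚ) ^ (-padicValRat 3 (QuadraticAlgebra.norm a)) ≤ ((3 : ℕ) : ℚ) ^ (-1 : ℤ) :=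
          zpow_le_zpow_right₀ (by norm_num) (by omega)
      _ = 1 / 3 := by norm_num

lemma padicNorm_three_mul_le {q : ℚ} (h : padicNorm 3 q ≤ 1) : padicNorm 3 (3 * q) ≤ 1 / 3 := by
  rw [padicNorm.mul, padicNorm_three]
  linarith

lemma κ_im : κ.im = -64 := by
  rw [κ, ε_sq]
  simp only [im_neg, im_mul, im_sub, re_sub, re_mul]
  have h1 : (16 : Fr).re = 16 := rfl
  have h2 : (16 : Fr).im = 0 := rfl
  have h3 : (4 : Fr).re = 4 := rfl
  have h4 : (4 : Fr).im = 0 := rfl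
  rw [h1, h2, h3, h4]
  norm_num

lemma padicNorm_le_one_of_ν {r : Fr} (h : ν r ≤ 1) : padicNorm 3 r.re ≤ 1 ∧ padicNorm 3 r.im ≤ 1 := by
  rw [ν_eq_max, max_le_iff] at h
  refine ⟨(sq_le_one_iff₀ (padicNorm.nonneg _)).1 h.1, ?_⟩
  by_contra! hlt
  rcases eq_or_ne r.im 0 with h0 | h0
  · rw [h0, padicNorm.zero] at hlt
    linarith
  · rw [padicNorm.eq_zpow_of_nonzero h0] at h hlt
    have h1 : ((3 : ℕ) : ℚ) ^ (0 : ℤ) < ((3 : ℕ) : ℚ) ^ (-padicValRat 3 r.im) := by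
      simpa using hlt
    rw [zpow_lt_zpow_iff_right₀ (by norm_num)] at h1
    have h2 : ((3 : ℕ) : ℚ) ^ (1 : ℤ) ≤ ((3 : ℕ) : ℚ) ^ (-padicValRat 3 r.im) :=
      zpow_le_zpow_right₀ (by norm_num) (by omega)
    rw [zpow_one] at h2
    push_cast at h2 h
    nlinarith [h.2]

lemma ν_y_eq_one {x y : Fr} (h : y ^ 2 = x ^ 3 + κ) (hx : ν x ≤ 1) : ν y = 1 := by
  have hy : ν y ≤ 1 := by
    have : ν (y ^ 2) ≤ 1 := by
      rw [h]
      exact add_mem (pow_mem (mem_𝒪.2 hx) 3) κ_mem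
    rw [ν_pow] at this
    exact (sq_le_one_iff₀ (ν_nonneg y)).1 this
  by_contra hne
  have h3 := ν_le_third (lt_of_le_of_ne hy hne)
  have hy2 : ν (y ^ 2) ≤ 1 / 9 := by
    rw [ν_pow]
    nlinarith [ν_nonneg y]
  obtain ⟨ha, hb⟩ := padicNorm_le_one_of_ν hx
  have him : (y ^ 2).im + 3 * -(x.re ^ 2 * x.im + x.im ^ 3) = -64 := by
    rw [h, im_add, κ_im]
    have : (x ^ 3).im = 3 * (x.re ^ 2 * x.im + x.im ^ 3) := by
      rw [pow_succ, sq]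
      simp only [im_mul, re_mul]
      ring
    rw [this]
    ring
  have h64 : padicNorm 3 (-64 : ℚ) = 1 := by
    have := padicNorm.nat_eq_one_iff (p := 3) 64
    rw [padicNorm.neg]
    exact_mod_cast this.2 (by norm_num)
  have hc : padicNorm 3 (-(x.re ^ 2 * x.im + x.im ^ 3)) ≤ 1 := by
    have hpow : ∀ (q : ℚ) (n : ℕ), padicNorm 3 q ≤ 1 → padicNorm 3 (q ^ n) ≤ 1 := by
      intro q n hq
      induction n with
      | zero => simp
      | succ n ih =>
        rw [pow_succ, padicNorm.mul]
        exact mul_le_one₀ ih (padicNorm.nonneg _) hq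
    rw [padicNorm.neg]
    refine padicNorm.nonarchimedean.trans (max_le ?_ (hpow _ _ hb))
    rw [padicNorm.mul]
    exact mul_le_one₀ (hpow _ _ ha) (padicNorm.nonneg _) hb
  have hy3 : padicNorm 3 (y ^ 2).im ^ 2 / 3 ≤ 1 / 9 := by
    rw [ν_eq_max] at hy2
    exact (le_max_right _ _).trans hy2
  have hy4 : padicNorm 3 (y ^ 2).im < 1 := by
    nlinarith [padicNorm.nonneg (p := 3) (y ^ 2).im]
  have : padicNorm 3 (-64 : ℚ) < 1 := by
    rw [← him]
    exact padicNorm.nonarchimedean.trans_lt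
      (max_lt hy4 ((padicNorm_three_mul_le hc).trans_lt (by norm_num)))
  rw [h64] at this
  exact lt_irrefl _ this

lemma ν_y_sq {x y : Fr} (h : y ^ 2 = x ^ 3 + κ) (hx : 1 ≤ ν x) : ν y ^ 2 = ν x ^ 3 := by
  rcases hx.eq_or_lt with hx | hx
  · rw [← hx, ν_y_eq_one h hx.ge]
    norm_num
  · rw [← ν_pow, ← ν_pow]
    apply ν_eq_of_sub_lt
    rw [h, add_sub_cancel_left, ν_κ, ν_pow]
    exact one_lt_pow₀ hx (by norm_num)

/-- Congruences modulo `3` do not change the absolute value of a unit. -/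
lemma ν_eq_one_of_sub_eq {a b c : Fr} (hb : ν b = 1) (hc : c ∈ 𝒪) (h : a = b + 3 * c) : ν a = 1 := by
  rw [← hb]
  apply ν_eq_of_sub_lt
  rw [h, add_sub_cancel_left, hb]
  exact (ν_three_mul_le hc).trans_lt (by norm_num)

/-- The parameter `κ / x³` of a point outside the open unit disc. -/
lemma exists_eq_mul_cube {x y : Fr} (h : y ^ 2 = x ^ 3 + κ) (hx : 1 ≤ ν x) :
    ∃ t ∈ 𝒪, κ = t * x ^ 3 ∧ ν (1 + t) = 1 := by
  have hx0 := x_ne_zero h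
  have hx3 := pow_ne_zero 3 hx0
  refine ⟨κ / x ^ 3, ?_, (div_mul_cancel₀ _ hx3).symm, ?_⟩
  · rw [mem_𝒪, ν_div, ν_κ, ν_pow]
    exact (div_le_one (by positivity)).2 (one_le_pow₀ hx)
  · rw [one_add_div hx3, ← h, ν_div, ν_pow, ν_pow, ν_y_sq h hx]
    exact div_self (by positivity)

lemma ν_nine : ν 9 = 1 / 81 := by
  rw [show (9 : Fr) = 3 ^ 2 by norm_num, ν_pow, ν_three]
  norm_num

lemma ν_tripled_x_of_one_le {x t : Fr} (ht : t ∈ 𝒪) (hu : ν (1 + t) = 1) (hx : 1 ≤ ν x) :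
    ν ((x ^ 9 - 96 * (t * x ^ 3) * x ^ 6 + 48 * (t * x ^ 3) ^ 2 * x ^ 3 + 64 * (t * x ^ 3) ^ 3)
      / (9 * x ^ 2 * (x ^ 3 + 4 * (t * x ^ 3)) ^ 2)) = 81 * ν x := by
  have e1 : x ^ 9 - 96 * (t * x ^ 3) * x ^ 6 + 48 * (t * x ^ 3) ^ 2 * x ^ 3 + 64 * (t * x ^ 3) ^ 3 =
      x ^ 9 * (1 - 96 * t + 48 * t ^ 2 + 64 * t ^ 3) := by
    ring
  have e2 : x ^ 3 + 4 * (t * x ^ 3) = x ^ 3 * (1 + 4 * t) := by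
    ring
  have u1 : ν (1 - 96 * t + 48 * t ^ 2 + 64 * t ^ 3) = 1 := by
    refine ν_eq_one_of_sub_eq (b := (1 + t) ^ 3) (c := -33 * t + 15 * t ^ 2 + 21 * t ^ 3)
      (by rw [ν_pow, hu, one_pow]) ?_ (by ring)
    aesop
  have u2 : ν (1 + 4 * t) = 1 := ν_eq_one_of_sub_eq hu ht (by ring)
  rw [e1, e2]
  simp only [ν_div, ν_mul, ν_pow, u1, u2, ν_nine]
  field_simp

lemma ν_tripled_x_of_lt_one {x y k : Fr} (hk : k ∈ 𝒪) (h : y ^ 2 = x ^ 3 + k) (hy : ν y = 1)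
    (hx0 : x ≠ 0) (hx : ν x < 1) :
    81 ≤ ν ((x ^ 9 - 96 * k * x ^ 6 + 48 * k ^ 2 * x ^ 3 + 64 * k ^ 3)
      / (9 * x ^ 2 * (x ^ 3 + 4 * k) ^ 2)) := by
  have hxm : x ∈ 𝒪 := hx.le
  have u1 : ν (x ^ 9 - 96 * k * x ^ 6 + 48 * k ^ 2 * x ^ 3 + 64 * k ^ 3) = 1 := by
    refine ν_eq_one_of_sub_eq (b := (y ^ 2) ^ 3)
      (c := -33 * k * x ^ 6 + 15 * k ^ 2 * x ^ 3 + 21 * k ^ 3) (by simp [ν_pow, hy]) ?_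
      (by rw [h]; ring)
    aesop
  have u2 : ν (x ^ 3 + 4 * k) = 1 :=
    ν_eq_one_of_sub_eq (b := y ^ 2) (by simp [ν_pow, hy]) hk (by rw [h]; ring)
  have := ν_pos hx0
  simp only [ν_div, ν_mul, ν_pow, u1, u2, ν_nine]
  rw [le_div_iff₀ (by positivity)]
  nlinarith

lemma exists_isAt_triple {D : (mordell κ).Point} {x y : Fr} (hD : IsAt D x y) :
    ∃ x' y', IsAt ((3 : ℕ) • D) x' y' ∧ 81 ≤ ν x' ∧ (1 ≤ ν x → ν x' = 81 * ν x) := by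
  have h := hD.equation
  refine ⟨_, _, hD.triple (x_ne_zero h) (y_ne_zero h) tripling_ne_zero, ?_⟩
  rcases le_or_gt 1 (ν x) with hx | hx
  · obtain ⟨t, ht, hκ, hu⟩ := exists_eq_mul_cube h hx
    have := ν_tripled_x_of_one_le ht hu hx
    rw [← hκ] at this
    rw [this]
    exact ⟨by linarith, fun _ => rfl⟩
  · exact ⟨ν_tripled_x_of_lt_one κ_mem h (ν_y_eq_one h hx.le) (x_ne_zero h) hx,
      fun h1 => absurd h1 (not_le.2 hx)⟩

/-- The point `D` lies in the `k`-th layer of the formal group, with prescribed leading term. -/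
def Layer (k : ℕ) (σ : Fr) (D : (mordell κ).Point) : Prop :=
  ∃ x y, IsAt D x y ∧ 1 ≤ ν x ∧ ν (x / y - σ * 3 ^ k * (1 + s)) ≤ (1 / 9) ^ (k + 1)

lemma ν_one_add_s : ν (1 + s) = 1 := by
  rw [← ν_one]
  apply ν_eq_of_sub_lt
  rw [add_sub_cancel_left, ν_s, ν_one]
  norm_num

lemma ν_eq_of_layer {k : ℕ} {σ z : Fr} (hσ : ν σ = 1)
    (h : ν (z - σ * 3 ^ k * (1 + s)) ≤ (1 / 9) ^ (k + 1)) : ν z = (1 / 9) ^ k := by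
  have h1 : ν (σ * 3 ^ k * (1 + s)) = (1 / 9) ^ k := by
    rw [ν_mul, ν_mul, ν_pow, hσ, ν_three, ν_one_add_s]
    ring
  rw [← h1]
  apply ν_eq_of_sub_lt
  rw [h1]
  refine h.trans_lt (pow_lt_pow_right_of_lt_one₀ (by norm_num) (by norm_num) (by omega))

/-- Tripling multiplies the parameter `x / y` by `3`, up to a relative error `3²`. -/
lemma tripled_ratio {x y t : Fr} (hx : x ≠ 0) (hy : y ≠ 0) (ht : t ∈ 𝒪) (hu : ν (1 + t) = 1) :
    ∃ c ∈ 𝒪, (x ^ 9 - 96 * (t * x ^ 3) * x ^ 6 + 48 * (t * x ^ 3) ^ 2 * x ^ 3 + 64 * (t * x ^ 3) ^ 3)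
      / (9 * x ^ 2 * (x ^ 3 + 4 * (t * x ^ 3)) ^ 2) /
      (y * ((x ^ 3 - 8 * (t * x ^ 3)) * ((x ^ 3 + 4 * (t * x ^ 3)) ^ 3 + 216 * (t * x ^ 3) * x ^ 6))
        / (27 * x ^ 3 * (x ^ 3 + 4 * (t * x ^ 3)) ^ 3)) = 3 * (x / y) + 9 * (x / y) * c := by
  have hd : ν ((1 - 8 * t) * ((1 + 4 * t) ^ 3 + 216 * t)) = 1 := by
    refine ν_eq_one_of_sub_eq (b := (1 + t) ^ 4)
      (c := 72 * t - 594 * t ^ 2 - 108 * t ^ 3 - 171 * t ^ 4)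
      (by rw [ν_pow, hu, one_pow]) ?_ (by ring)
    aesop
  have u2 : ν (1 + 4 * t) = 1 := ν_eq_one_of_sub_eq hu ht (by ring)
  have h4 : 1 + 4 * t ≠ 0 := by
    intro h0
    rw [h0, ν_zero] at u2
    norm_num at u2
  have hd0 : (1 - 8 * t) * ((1 + 4 * t) ^ 3 + 216 * t) ≠ 0 := by
    intro h0
    rw [h0, ν_zero] at hd
    norm_num at hd
  have hc : -104 * t + 480 * t ^ 2 + 192 * t ^ 3 + 256 * t ^ 4 ∈ 𝒪 :=
    by aesop
  refine ⟨(-104 * t + 480 * t ^ 2 + 192 * t ^ 3 + 256 * t ^ 4)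
    / ((1 - 8 * t) * ((1 + 4 * t) ^ 3 + 216 * t)), ?_, ?_⟩
  · rw [mem_𝒪, ν_div, hd, div_one]
    exact hc
  · have e1 : x ^ 3 + 4 * (t * x ^ 3) = x ^ 3 * (1 + 4 * t) := by ring
    have e2 : (x ^ 3 - 8 * (t * x ^ 3)) * ((x ^ 3 * (1 + 4 * t)) ^ 3 + 216 * (t * x ^ 3) * x ^ 6)
        = x ^ 12 * ((1 - 8 * t) * ((1 + 4 * t) ^ 3 + 216 * t)) := by ring
    have e3 : 3 * (x / y) + 9 * (x / y) * ((-104 * t + 480 * t ^ 2 + 192 * t ^ 3 + 256 * t ^ 4)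
        / ((1 - 8 * t) * ((1 + 4 * t) ^ 3 + 216 * t))) = 3 * (x / y) *
        ((1 - 96 * t + 48 * t ^ 2 + 64 * t ^ 3) * (1 + 4 * t)
          / ((1 - 8 * t) * ((1 + 4 * t) ^ 3 + 216 * t))) := by
      rw [eq_comm, ← sub_eq_zero]
      have : (1 - 96 * t + 48 * t ^ 2 + 64 * t ^ 3) * (1 + 4 * t) =
        ((1 - 8 * t) * ((1 + 4 * t) ^ 3 + 216 * t)) +
          3 * (-104 * t + 480 * t ^ 2 + 192 * t ^ 3 + 256 * t ^ 4) := by ring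
      rw [this, add_div, div_self hd0]
      ring
    rw [e1, e2, e3]
    generalize (1 - 8 * t) * ((1 + 4 * t) ^ 3 + 216 * t) = d at *
    field_simp
    ring

lemma Layer.triple {k : ℕ} {σ : Fr} (hσ : ν σ = 1) {D : (mordell κ).Point} (hD : Layer k σ D) :
    Layer (k + 1) σ ((3 : ℕ) • D) := by
  obtain ⟨x, y, hD, hx, hz⟩ := hD
  have h := hD.equation
  obtain ⟨x', y', hD', hx', -⟩ := exists_isAt_triple hD
  refine ⟨x', y', hD', by linarith, ?_⟩
  obtain ⟨t, ht, hκ, hu⟩ := exists_eq_mul_cube h hx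
  obtain ⟨rfl, rfl⟩ := hD'.unique (hD.triple (x_ne_zero h) (y_ne_zero h) tripling_ne_zero)
  obtain ⟨c, hc, he⟩ := tripled_ratio (x_ne_zero h) (y_ne_zero h) ht hu
  rw [← hκ] at he
  rw [he]
  have hνz := ν_eq_of_layer hσ hz
  generalize x / y = z at *
  rw [show 3 * z + 9 * z * c - σ * 3 ^ (k + 1) * (1 + s) = 3 * (z - σ * 3 ^ k * (1 + s)) + 9 * z * c by
    ring]
  apply ν_add_le
  · rw [ν_mul, ν_three, pow_succ _ (k + 1)]
    linarith
  · rw [ν_mul, ν_mul, ν_nine, hνz]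
    calc 1 / 81 * (1 / 9) ^ k * ν c ≤ 1 / 81 * (1 / 9) ^ k * 1 := by gcongr; exact hc
      _ = (1 / 9) ^ (k + 1 + 1) := by ring

/-- Adding a point in the formal group, in terms of its parameters `z = x / y` and `u = 1 / x`. -/
lemma IsAt.add_formal {k : Fr} {P D : (mordell k).Point} {x₁ y₁ z u : Fr} (h₁ : IsAt P x₁ y₁)
    (hz : z ≠ 0) (hu : u ≠ 0) (h₂ : IsAt D (1 / u) (1 / (z * u))) (h0 : 1 - x₁ * u ≠ 0) :
    IsAt (P + D)
      (x₁ + (1 + k * u ^ 3) * z * (3 * x₁ ^ 2 * z - 2 * y₁ + (2 * k - x₁ ^ 3) * z * u)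
        / (1 - x₁ * u) ^ 2)
      (-y₁ - (1 + k * u ^ 3) * (1 - y₁ * z * u)
        * (3 * x₁ ^ 2 * z - 2 * y₁ + (2 * k - x₁ ^ 3) * z * u) / (1 - x₁ * u) ^ 3) := by
  have e₁ := h₁.equation
  have e₂ : u = z ^ 2 * (1 + k * u ^ 3) := by
    have := h₂.equation
    field_simp at this
    linear_combination this
  have hr : 1 + k * u ^ 3 = u / z ^ 2 := by
    rw [eq_div_iff (pow_ne_zero _ hz)]
    linear_combination -e₂
  have hne : x₁ ≠ 1 / u := by
    intro h
    apply h0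
    rw [h]
    field_simp
    ring
  refine h₁.add (l := (1 - y₁ * z * u) / (z * (1 - x₁ * u))) h₂ hne ?_ ?_ ?_
  · rw [div_mul_eq_mul_div, div_eq_iff (mul_ne_zero hz h0)]
    field_simp
    ring
  · rw [hr]
    field_simp
    linear_combination (-1 : Fr) * e₂ - z ^ 2 * u ^ 3 * e₁
  · rw [hr]
    have h0' : 1 - u * x₁ ≠ 0 := by rwa [mul_comm]
    field_simp
    ring

lemma sq_ν_parameter {x y : Fr} (h : y ^ 2 = x ^ 3 + κ) (hx : 1 ≤ ν x) :
    ν (x / y) ^ 2 = 1 / ν x := by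
  rw [ν_div, div_pow, ν_y_sq h hx]
  field_simp

lemma formal_x_mem {k z u x y : Fr} (hk : k ∈ 𝒪) (hz : z ∈ 𝒪) (hu : u ∈ 𝒪) (hx : x ∈ 𝒪)
    (hy : y ∈ 𝒪) :
    (1 + k * u ^ 3) * (3 * x ^ 2 * z - 2 * y + (2 * k - x ^ 3) * z * u) ∈ 𝒪 := by
  lift k to 𝒪 using hk
  lift z to 𝒪 using hz
  lift u to 𝒪 using hu
  lift x to 𝒪 using hx
  lift y to 𝒪 using hy
  exact_mod_cast ((1 + k * u ^ 3) * (3 * x ^ 2 * z - 2 * y + (2 * k - x ^ 3) * z * u)).2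

lemma formal_y_expansion {k z u x y : Fr} (hk : k ∈ 𝒪) (hz : z ∈ 𝒪) (hu : u ∈ 𝒪) (hx : x ∈ 𝒪)
    (hy : y ∈ 𝒪) (h0 : 1 - x * u ≠ 0) :
    ∃ c₁ ∈ 𝒪, ∃ c₂ ∈ 𝒪, -y - (1 + k * u ^ 3) * (1 - y * z * u)
        * (3 * x ^ 2 * z - 2 * y + (2 * k - x ^ 3) * z * u) / (1 - x * u) ^ 3 -
        (y - 3 * x ^ 2 * z) = u * (3 * (2 * x * y) + z * c₁ + u * c₂) / (1 - x * u) ^ 3 := by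
  refine ⟨-(2 * k - x ^ 3) - y * (2 * y - 3 * x ^ 2 * z) + y * (2 * k - x ^ 3) * z * u - 9 * x ^ 3,
    ?_, k * u * (1 - y * z * u) * (2 * y - 3 * x ^ 2 * z - (2 * k - x ^ 3) * z * u)
      + (2 * y - 3 * x ^ 2 * z) * (-3 * x ^ 2 + x ^ 3 * u), ?_, ?_⟩
  · lift k to 𝒪 using hk
    lift z to 𝒪 using hz
    lift u to 𝒪 using hu
    lift x to 𝒪 using hx
    lift y to 𝒪 using hy
    exact_mod_cast (-(2 * k - x ^ 3) - y * (2 * y - 3 * x ^ 2 * z) + y * (2 * k - x ^ 3) * z * u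
      - 9 * x ^ 3).2
  · lift k to 𝒪 using hk
    lift z to 𝒪 using hz
    lift u to 𝒪 using hu
    lift x to 𝒪 using hx
    lift y to 𝒪 using hy
    exact_mod_cast (k * u * (1 - y * z * u) * (2 * y - 3 * x ^ 2 * z - (2 * k - x ^ 3) * z * u)
      + (2 * y - 3 * x ^ 2 * z) * (-3 * x ^ 2 + x ^ 3 * u)).2
  · have h0' : 1 - u * x ≠ 0 := by rwa [mul_comm]
    field_simp
    ring

/-- Translating by a point close to the origin. -/
lemma exists_isAt_add {P D : (mordell κ).Point} {x₁ y₁ x₂ y₂ : Fr} (h₁ : IsAt P x₁ y₁)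
    (hx₁ : ν x₁ = 1) (h₂ : IsAt D x₂ y₂) (hx₂ : 81 ≤ ν x₂) :
    ∃ x y, IsAt (P + D) x y ∧ ν (x - x₁) ≤ 1 / 9 ∧
      ν (y - (y₁ - 3 * x₁ ^ 2 * (x₂ / y₂))) ≤ 1 / 9 * ν (x₂ / y₂) ^ 2 := by
  have hx0 := x_ne_zero h₂.equation
  have hy0 := y_ne_zero h₂.equation
  have hy₁ := ν_y_eq_one h₁.equation hx₁.le
  have hνz := sq_ν_parameter h₂.equation (by linarith)
  obtain ⟨z, hz⟩ : ∃ z, z = x₂ / y₂ := ⟨_, rfl⟩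
  obtain ⟨u, hu⟩ : ∃ u, u = 1 / x₂ := ⟨_, rfl⟩
  have hz0 : z ≠ 0 := by rw [hz]; exact div_ne_zero hx0 hy0
  have hu0 : u ≠ 0 := by rw [hu]; exact one_div_ne_zero hx0
  have hzu : ν z ^ 2 = ν u := by rw [hz, hνz, hu, ν_div, ν_one]
  have hu81 : ν u ≤ 1 / 81 := by
    rw [hu, ν_div, ν_one]
    exact one_div_le_one_div_of_le (by norm_num) hx₂
  have hz9 : ν z ≤ 1 / 9 := by
    rw [← hzu] at hu81
    nlinarith [ν_nonneg z]
  have hxu : x₂ = 1 / u := by rw [hu, one_div_one_div]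
  have hyu : y₂ = 1 / (z * u) := by
    rw [hz, hu]
    field_simp
  rw [← hz]
  rw [hxu, hyu] at h₂
  have hm : ∀ {a : Fr}, ν a ≤ 1 → a ∈ 𝒪 := fun h => h
  have hzm : z ∈ 𝒪 := hm (by linarith)
  have hum : u ∈ 𝒪 := hm (by linarith)
  have hxm : x₁ ∈ 𝒪 := hm hx₁.le
  have hym : y₁ ∈ 𝒪 := hm hy₁.le
  have hκ := κ_mem
  have hd : ν (1 - x₁ * u) = 1 := by
    apply ν_eq_one_of_sub_one
    rw [show 1 - x₁ * u - 1 = -(x₁ * u) by ring, ν_neg, ν_mul, hx₁]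
    linarith
  have hd0 : 1 - x₁ * u ≠ 0 := by
    intro h
    rw [h, ν_zero] at hd
    norm_num at hd
  refine ⟨_, _, h₁.add_formal hz0 hu0 h₂ hd0, ?_, ?_⟩
  · have := formal_x_mem hκ hzm hum hxm hym
    rw [add_sub_cancel_left, mul_right_comm, mul_comm _ z, ν_div, ν_pow, hd, ν_mul]
    have := mul_le_mul hz9 (mem_𝒪.1 this) (ν_nonneg _) (by norm_num)
    linarith
  · obtain ⟨c₁, hc₁, c₂, hc₂, he⟩ := formal_y_expansion hκ hzm hum hxm hym hd0
    rw [he, ν_div, ν_pow, hd, ν_mul, hzu, one_pow, div_one, mul_comm]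
    refine mul_le_mul_of_nonneg_right ?_ (ν_nonneg u)
    have hb : ∀ {a b : Fr}, ν a ≤ 1 / 9 → b ∈ 𝒪 → ν (a * b) ≤ 1 / 9 := fun {a b} ha hb => by
      rw [ν_mul]
      have := mul_le_mul ha (mem_𝒪.1 hb) (ν_nonneg _) (by norm_num)
      linarith
    exact ν_add_le (ν_add_le (hb ν_three.le (mul_mem (mul_mem (ofNat_mem 𝒪 2) hxm) hym)) (hb hz9 hc₁)) (hb (by linarith) hc₂)

lemma ν_sign {σ : Fr} (hσ : σ ^ 2 = 1) : ν σ = 1 := by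
  have := ν_pow σ 2
  rw [hσ, ν_one] at this
  exact (pow_eq_one_iff_of_nonneg (ν_nonneg σ) two_ne_zero).1 this.symm

lemma ν_four_mul_ε : ν (4 * ε) = 1 := by
  rw [ν_mul, ν_four, ν_ε, one_mul]

lemma layer_zero {D : (mordell κ).Point} {x y σ : Fr} (hσ : σ ^ 2 = 1) (hD : IsAt D x y)
    (hx : ν (x - 4 * ε) ≤ 1 / 9) (hy : ν (y - σ * -(4 * ε ^ 2)) ≤ 1 / 9) : Layer 0 σ D := by
  have hσ1 := ν_sign hσ
  have hνx : ν x = 1 := by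
    rw [← ν_four_mul_ε]
    apply ν_eq_of_sub_lt
    rw [ν_four_mul_ε]
    linarith
  have hνy := ν_y_eq_one hD.equation hνx.le
  refine ⟨x, y, hD, hνx.ge, ?_⟩
  have e : x / y - σ * 3 ^ 0 * (1 + s)
      = ((x - 4 * ε) - σ * (1 + s) * (y - σ * -(4 * ε ^ 2)) + 3 * (4 * ε * ε)) / y := by
    rw [eq_div_iff (y_ne_zero hD.equation), sub_mul, div_mul_cancel₀ _ (y_ne_zero hD.equation)]
    linear_combination (4 * ε ^ 2 * (1 + s)) * hσ + (4 * ε * (s - 2)) * ε_eq + (4 * ε) * s_sq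
  rw [e, ν_div, hνy, div_one, zero_add, pow_one]
  refine ν_add_le (ν_sub_le hx ?_) (ν_three_mul_le ?_)
  · rwa [ν_mul, ν_mul, hσ1, ν_one_add_s, one_mul, one_mul]
  · rw [mem_𝒪, ν_mul, ν_four_mul_ε, ν_ε, one_mul]

lemma triple_eq_zero_or (A : (mordell κ).Point) :
    (3 : ℕ) • A = 0 ∨ ∃ x y, IsAt ((3 : ℕ) • A) x y ∧ 81 ≤ ν x := by
  rcases eq_zero_or_isAt A with rfl | ⟨x, y, hA⟩
  · exact Or.inl (nsmul_zero _)
  · obtain ⟨x', y', h, hlarge, -⟩ := exists_isAt_triple hA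
    exact Or.inr ⟨x', y', h, hlarge⟩

/-- Points congruent to a point `P` with `√3`-integral coordinates. -/
lemma exists_isAt_add_triple {P : (mordell κ).Point} {x y : Fr} (hP : IsAt P x y) (hx : ν x = 1)
    (A : (mordell κ).Point) :
    ∃ x' y', IsAt (P + (3 : ℕ) • A) x' y' ∧ ν (x' - x) ≤ 1 / 9 ∧ ν (y' - y) ≤ 1 / 9 := by
  rcases triple_eq_zero_or A with h | ⟨x₂, y₂, h, h81⟩
  · refine ⟨x, y, by rwa [h, add_zero], ?_, ?_⟩ <;> simp [ν_zero]
  · obtain ⟨x', y', h', hx', hy'⟩ := exists_isAt_add hP hx h h81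
    refine ⟨x', y', h', hx', ?_⟩
    have hz := sq_ν_parameter h.equation (by linarith)
    have h2 : ν (x₂ / y₂) ^ 2 ≤ 1 := by
      rw [hz]
      exact (div_le_one (by linarith)).2 (by linarith)
    have h1 := (sq_le_one_iff₀ (ν_nonneg _)).1 h2
    rw [show y' - y = (y' - (y - 3 * x ^ 2 * (x₂ / y₂))) - 3 * (x ^ 2 * (x₂ / y₂)) by ring]
    refine ν_sub_le (by linarith) (ν_three_mul_le ?_)
    rwa [mem_𝒪, ν_mul, ν_pow, hx, one_pow, one_mul]

lemma layer_of_triple (n : ℕ) : ∀ {A : (mordell κ).Point} {x y : Fr},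
    IsAt ((3 : ℕ) • A) x y → ν x ≤ 81 ^ n → ∃ k σ, 1 ≤ k ∧ σ ^ 2 = 1 ∧ Layer k σ ((3 : ℕ) • A) := by
  induction n with
  | zero =>
    intro A x y h hx
    rcases triple_eq_zero_or A with h0 | ⟨x', y', h', h81⟩
    · exact absurd h0 h.ne_zero
    · obtain ⟨rfl, rfl⟩ := h.unique h'
      linarith
  | succ n ih =>
    intro A x y h hx
    have hA0 : A ≠ 0 := by
      rintro rfl
      exact h.ne_zero (nsmul_zero _)
    obtain ⟨A', rfl | rfl | rfl⟩ := exists_eq_base_add_triple A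
    · rcases triple_eq_zero_or A' with h0 | ⟨x', y', h', h81⟩
      · exact absurd h0 hA0
      · obtain ⟨x₁, y₁, h₁, -, hx₁⟩ := exists_isAt_triple h'
        obtain ⟨rfl, rfl⟩ := h.unique h₁
        have := hx₁ (by linarith)
        obtain ⟨k, σ, hk, hσ, hL⟩ := ih h' (by rw [pow_succ] at hx; linarith)
        exact ⟨k + 1, σ, by omega, hσ, hL.triple (ν_sign hσ)⟩
    · obtain ⟨x', y', h', hx', hy'⟩ := exists_isAt_add_triple isAt_base ν_four_mul_ε A'
      have hσ : (1 : Fr) ^ 2 = 1 := one_pow 2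
      exact ⟨1, 1, le_rfl, hσ, (layer_zero hσ h' hx' (by rwa [one_mul])).triple (ν_sign hσ)⟩
    · obtain ⟨x', y', h', hx', hy'⟩ := exists_isAt_add_triple isAt_base.neg ν_four_mul_ε A'
      have hσ : (-1 : Fr) ^ 2 = 1 := by norm_num
      exact ⟨1, -1, le_rfl, hσ, (layer_zero hσ h' hx' (by rwa [neg_one_mul])).triple (ν_sign hσ)⟩

lemma exists_layer_of_triple {A : (mordell κ).Point} {x y : Fr} (h : IsAt ((3 : ℕ) • A) x y) :
    ∃ k σ, 1 ≤ k ∧ σ ^ 2 = 1 ∧ Layer k σ ((3 : ℕ) • A) := by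
  obtain ⟨n, hn⟩ := pow_unbounded_of_one_lt (ν x) (show (1 : ℚ) < 81 by norm_num)
  exact layer_of_triple n h hn.le

lemma re_sq_le_of_ν {r : Fr} {c : ℚ} (h : ν r ≤ c) : padicNorm 3 r.re ^ 2 ≤ c := by
  rw [ν_eq_max] at h
  exact (le_max_left _ _).trans h

lemma im_sq_le_of_ν {r : Fr} {c : ℚ} (h : ν r ≤ c) : padicNorm 3 r.im ^ 2 ≤ 3 * c := by
  rw [ν_eq_max] at h
  linarith [(le_max_right _ _).trans h]

lemma padicNorm_natCast_eq_one {n : ℕ} (h : ¬ 3 ∣ n) : padicNorm 3 (n : ℚ) = 1 :=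
  (padicNorm.nat_eq_one_iff n).2 h

lemma padicNorm_add_lt {a b c : ℚ} (ha : padicNorm 3 a < c) (hb : padicNorm 3 b < c) :
    padicNorm 3 (a + b) < c :=
  padicNorm.nonarchimedean.trans_lt (max_lt ha hb)

lemma padicNorm_mul_lt {a b c : ℚ} (ha : padicNorm 3 a ≤ 1) (hb : padicNorm 3 b < c) :
    padicNorm 3 (a * b) < c := by
  rw [padicNorm.mul]
  nlinarith [padicNorm.nonneg (p := 3) a, padicNorm.nonneg (p := 3) b]

lemma padicNorm_intCast_le (n : ℤ) : padicNorm 3 (n : ℚ) ≤ 1 := padicNorm.of_int n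

lemma s_mul_div_three (R : Fr) : s * (2 * R + 1) / 3 = ⟨2 * R.im, (2 * R.re + 1) / 3⟩ := by
  have h3 : (3 : Fr) = QuadraticAlgebra.C 3 := rfl
  have h2 : (2 : Fr) = QuadraticAlgebra.C 2 := rfl
  rw [div_eq_iff three_ne_zero, h3, h2]
  ext <;> simp only [re_mul, im_mul, re_add, im_add, re_C, im_C, re_one, im_one] <;> ring

/-- Norm-one elements in the residue disc of `ε` are excluded. -/
lemma not_near_neg_base {R : Fr} (hN : QuadraticAlgebra.norm R = 1)
    (h : ν (4 * s * ε * (2 * R + 1) / 3 - 4 * ε ^ 2) ≤ 1 / 9) : False := by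
  have h1 : ν (s * (2 * R + 1) / 3 - ε) ≤ 1 / 9 := by
    rw [show 4 * s * ε * (2 * R + 1) / 3 - 4 * ε ^ 2 = 4 * ε * (s * (2 * R + 1) / 3 - ε) by ring,
      ν_mul, ν_four_mul_ε, one_mul] at h
    exact h
  have e : s * (2 * R + 1) / 3 - ε = ⟨2 * R.im - 2, (2 * R.re + 1) / 3 - 1⟩ := by
    rw [s_mul_div_three]
    rfl
  rw [e] at h1
  have ha := re_sq_le_of_ν h1
  have hb := im_sq_le_of_ν h1
  rw [norm_def] at hN
  simp only at ha hb
  generalize ha' : 2 * R.im - 2 = a at ha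
  generalize hb' : (2 * R.re + 1) / 3 - 1 = b at hb
  have h4 : (4 + 3 * b) * b + (-4 - a) * a = 4 := by
    rw [← ha', ← hb']
    linear_combination (4 / 3) * hN
  have ha1 : padicNorm 3 a < 1 := by nlinarith [padicNorm.nonneg (p := 3) a]
  have hb1 : padicNorm 3 b < 1 := by nlinarith [padicNorm.nonneg (p := 3) b]
  have hlt : padicNorm 3 (4 : ℚ) < 1 := by
    rw [← h4]
    apply padicNorm_add_lt
    · apply padicNorm_mul_lt _ hb1
      apply padicNorm.nonarchimedean.trans (max_le _ _)
      · exact_mod_cast padicNorm_intCast_le 4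
      · exact (padicNorm_mul_lt (by exact_mod_cast padicNorm_intCast_le 3) hb1).le
    · apply padicNorm_mul_lt _ ha1
      rw [sub_eq_add_neg]
      apply padicNorm.nonarchimedean.trans (max_le _ _)
      · exact_mod_cast padicNorm_intCast_le (-4)
      · rw [padicNorm.neg]
        exact ha1.le
  have := padicNorm_natCast_eq_one (n := 4) (by norm_num)
  push_cast at this
  rw [this] at hlt
  exact lt_irrefl _ hlt

lemma not_near_base {R z σ : Fr} {k : ℕ} (hk : 1 ≤ k) (hN : QuadraticAlgebra.norm R = 1)
    (hσ : σ ^ 2 = 1) (hz : ν (z - σ * 3 ^ k * (1 + s)) ≤ (1 / 9) ^ (k + 1))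
    (h : ν (4 * s * ε * (2 * R + 1) / 3 - (-(4 * ε ^ 2) - 3 * (4 * ε) ^ 2 * z)) ≤ 1 / 9 * ν z ^ 2) :
    False := by
  have h1 : ν (s * (2 * R + 1) / 3 + ε + 12 * ε * z) ≤ 1 / 9 * ν z ^ 2 := by
    rw [show 4 * s * ε * (2 * R + 1) / 3 - (-(4 * ε ^ 2) - 3 * (4 * ε) ^ 2 * z)
      = 4 * ε * (s * (2 * R + 1) / 3 + ε + 12 * ε * z) by ring,
      ν_mul, ν_four_mul_ε, one_mul] at h
    exact h
  have hνz := ν_eq_of_layer (ν_sign hσ) hz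
  have hνσ := ν_sign hσ
  have h2 : ν (s * (2 * R + 1) / 3 + ε + 60 * (σ * 3 ^ k)) ≤ (1 / 9) ^ (k + 2) := by
    rw [show s * (2 * R + 1) / 3 + ε + 60 * (σ * 3 ^ k) = (s * (2 * R + 1) / 3 + ε + 12 * ε * z)
      - 3 * (4 * ε * (z - σ * 3 ^ k * (1 + s))) - 4 * 3 ^ 2 * σ * 3 ^ k * s by
        rw [ε_eq]
        linear_combination -12 * σ * 3 ^ k * s_sq]
    refine ν_sub_le (ν_sub_le (h1.trans ?_) ?_) ?_
    · rw [hνz, ← pow_mul, ← pow_succ']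
      exact pow_le_pow_of_le_one (by norm_num) (by norm_num) (by omega)
    · rw [ν_mul, ν_mul, ν_four_mul_ε, ν_three, one_mul, pow_succ' _ (k + 1)]
      gcongr
    · simp only [ν_mul, ν_pow, ν_three, ν_four, ν_s, hνσ]
      rw [pow_add]
      nlinarith [pow_pos (show (0 : ℚ) < 1 / 9 by norm_num) k]
  obtain ⟨c, hc, hσc⟩ : ∃ c : ℚ, padicNorm 3 c = 1 ∧ σ = ⟨c, 0⟩ := by
    have : (σ - 1) * (σ + 1) = 0 := by linear_combination hσ
    rcases mul_eq_zero.1 this with h0 | h0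
    · obtain rfl := sub_eq_zero.1 h0
      exact ⟨1, by simp, rfl⟩
    · obtain rfl := eq_neg_of_add_eq_zero_left h0
      exact ⟨-1, by simp, by ext <;> simp⟩
  have e : s * (2 * R + 1) / 3 + ε + 60 * (σ * 3 ^ k)
      = ⟨2 * R.im + 2 + 60 * (c * 3 ^ k), (2 * R.re + 1) / 3 + 1⟩ := by
    have h60 : (60 * (σ * 3 ^ k) : Fr) = ⟨60 * (c * 3 ^ k), 0⟩ := by
      have : (⟨60 * (c * 3 ^ k), 0⟩ : Fr) = algebraMap ℚ Fr (60 * (c * 3 ^ k)) := rfl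
      rw [this, hσc, map_mul, map_mul, map_pow]
      rfl
    rw [s_mul_div_three, h60]
    ext <;> simp
  rw [e] at h2
  have ha := re_sq_le_of_ν h2
  have hb := im_sq_le_of_ν h2
  rw [norm_def] at hN
  simp only at ha hb
  generalize ha' : 2 * R.im + 2 = a at ha
  generalize hb' : (2 * R.re + 1) / 3 + 1 = b at hb
  have h4 : a * a + (8 - 3 * b) * b = 4 * a := by
    rw [← ha', ← hb']
    linear_combination (-4 / 3) * hN
  have hpos : (0 : ℚ) < (1 / 3) ^ (k + 1) := by positivity
  have h9 : ((1 : ℚ) / 9) ^ (k + 2) = 1 / 9 * ((1 / 3) ^ (k + 1)) ^ 2 := by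
    rw [← pow_mul, mul_comm (k + 1), pow_mul, pow_succ' _ (k + 1)]
    norm_num
  have hr1 : ((1 : ℚ) / 3) ^ (k + 1) < 1 := pow_lt_one₀ (by norm_num) (by norm_num) (by omega)
  rw [h9] at ha hb
  have h60 : padicNorm 3 (60 * (c * 3 ^ k)) = (1 / 3) ^ (k + 1) := by
    have h3k : padicNorm 3 ((3 : ℚ) ^ k) = (1 / 3) ^ k := by
      clear * -
      induction k with
      | zero => simp
      | succ k ih => rw [pow_succ, padicNorm.mul, ih, padicNorm_three, pow_succ]
    have h20 := padicNorm_natCast_eq_one (n := 20) (by norm_num)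
    push_cast at h20
    rw [show (60 : ℚ) = 3 * 20 by norm_num, padicNorm.mul, padicNorm.mul, padicNorm.mul, hc, h20,
      h3k, padicNorm_three]
    ring
  generalize ((1 : ℚ) / 3) ^ (k + 1) = r at *
  have ha0 : padicNorm 3 (a + 60 * (c * 3 ^ k)) < r := by
    nlinarith [padicNorm.nonneg (p := 3) (a + 60 * (c * 3 ^ k))]
  have hb0 : padicNorm 3 b < r := by
    nlinarith [padicNorm.nonneg (p := 3) b]
  have ha1 : padicNorm 3 a = r := by
    rw [← h60, ← padicNorm.neg (60 * (c * 3 ^ k))]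
    have hne : padicNorm 3 (a + 60 * (c * 3 ^ k)) ≠ padicNorm 3 (-(60 * (c * 3 ^ k))) := by
      rw [padicNorm.neg, h60]
      exact ha0.ne
    have hmax := padicNorm.add_eq_max_of_ne hne
    rw [add_neg_cancel_right] at hmax
    rw [hmax, max_eq_right]
    rw [padicNorm.neg, h60]
    exact ha0.le
  have h4a : padicNorm 3 (4 * a) = r := by
    have := padicNorm_natCast_eq_one (n := 4) (by norm_num)
    push_cast at this
    rw [padicNorm.mul, this, ha1, one_mul]
  have hlt : padicNorm 3 (4 * a) < r := by
    rw [← h4]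
    apply padicNorm_add_lt
    · rw [padicNorm.mul, ha1]
      nlinarith
    · apply padicNorm_mul_lt _ hb0
      rw [sub_eq_add_neg]
      apply padicNorm.nonarchimedean.trans (max_le _ _)
      · exact_mod_cast padicNorm_intCast_le 8
      · rw [padicNorm.neg]
        exact (padicNorm_mul_lt (by exact_mod_cast padicNorm_intCast_le 3) hb0).le.trans hr1.le
  linarith

lemma eq_neg_ε {R v : Fr} (hN : QuadraticAlgebra.norm R = 1) (h : R ^ 2 + R + 1 = 3 * ε * v ^ 3) :
    R = -ε := by
  obtain ⟨Q, hQ⟩ := exists_isAt (x := 4 * ε * v) (y := 4 * s * ε * (2 * R + 1) / 3) κ_ne_zero (by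
    rw [κ]
    linear_combination (64 / 3) * ε ^ 2 * h + (16 / 9) * ε ^ 2 * (2 * R + 1) ^ 2 * s_sq)
  have hε := ε_ne_zero
  obtain ⟨A, hA | hA | hA⟩ := exists_eq_base_add_triple (Q - base)
  · rcases triple_eq_zero_or A with h0 | ⟨x, y, h3, h81⟩
    · rw [h0, sub_eq_zero] at hA
      obtain ⟨-, hy⟩ := hQ.unique (hA ▸ isAt_base)
      have : 8 * ε * (R + ε) = 0 := by
        linear_combination s * hy - (4 / 3) * ε * (2 * R + 1) * s_sq
          - 4 * ε * (s - 2) * ε_eq - 4 * ε * s_sq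
      rcases mul_eq_zero.1 this with h0 | h0
      · exact absurd h0 (mul_ne_zero (by norm_num) hε)
      · exact eq_neg_of_add_eq_zero_left h0
    · obtain ⟨k, σ, hk, hσ, x', y', h3', -, hz⟩ := exists_layer_of_triple h3
      obtain ⟨rfl, rfl⟩ := h3.unique h3'
      obtain ⟨x₁, y₁, hQ', -, hy⟩ := exists_isAt_add isAt_base ν_four_mul_ε h3 h81
      rw [← hA, add_sub_cancel] at hQ'
      obtain ⟨-, rfl⟩ := hQ'.unique hQ
      exact (not_near_base hk hN hσ hz hy).elim
  · obtain ⟨x', y', h', -, hy⟩ := exists_isAt_add_triple isAt_base.neg ν_four_mul_ε (base + A)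
    rw [show -base + (3 : ℕ) • (base + A) = base + (base + (3 : ℕ) • A) by
      rw [nsmul_add, show (3 : ℕ) • base = base + base + base by rw [succ_nsmul, two_nsmul]]; abel,
      ← hA, add_sub_cancel] at h'
    obtain ⟨-, rfl⟩ := h'.unique hQ
    rw [neg_neg] at hy
    exact (not_near_neg_base hN hy).elim
  · have hQA : Q = (3 : ℕ) • A := by
      rw [sub_eq_iff_eq_add] at hA
      rw [hA]
      abel
    rcases triple_eq_zero_or A with h0 | ⟨x, y, h3, h81⟩
    · exact absurd (hQA.trans h0) hQ.ne_zero
    · exfalso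
      rw [← hQA] at h3
      obtain ⟨rfl, rfl⟩ := h3.unique hQ
      have hy := ν_y_sq h3.equation (by linarith)
      have hR : ν R = 1 := by rw [ν, hN, padicNorm.one]
      have h21 : ν (2 * R + 1) ≤ 1 :=
        ν_add_le (by rw [ν_mul, ν_two, hR, one_mul]) ν_one.le
      have hle : ν (4 * s * ε * (2 * R + 1) / 3) ≤ 3 := by
        rw [ν_div, ν_three, ν_mul, ν_mul, ν_mul, ν_s, ν_four, ν_ε]
        linarith
      have h1 := ν_nonneg (4 * s * ε * (2 * R + 1) / 3)
      have : (81 : ℚ) ^ 3 ≤ ν (4 * ε * v) ^ 3 := by gcongr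
      rw [← hy] at this
      nlinarith

lemma algebraMap_eq (t : ℚ) : algebraMap ℚ Fr t = ⟨t, 0⟩ := rfl

lemma mk_eq (t u : ℚ) : (⟨t, u⟩ : Fr) = algebraMap ℚ Fr t + algebraMap ℚ Fr u * s := by
  rw [algebraMap_eq, algebraMap_eq]
  ext <;> simp

/-- The case in which `(t + √3) / (t - √3)` is `ε` times a cube. -/
lemma eq_one_of_eq_ε_mul_cube {t X : ℚ} {W : Fr} (hX : X ≠ 0)
    (ht : 3 - t ^ 2 = X ^ 3 * (1 + t ^ 2)) (h : (⟨t, 1⟩ : Fr) = ε * W ^ 3 * ⟨t, -1⟩) : t = 1 := by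
  have hW : QuadraticAlgebra.norm W = 1 :=
    norm_eq_one_of_eq_mul_cube (j := 1) (t := t) (by rwa [pow_one])
  have hN : QuadraticAlgebra.norm (ε * W ^ 3) = 1 := by
    have : QuadraticAlgebra.norm ε = 1 := by norm_num [norm_def]
    rw [map_mul, map_pow, hW, this, one_pow, one_mul]
  have hR : ε * W ^ 3 = -ε := by
    refine eq_neg_ε hN (v := -W / algebraMap ℚ Fr X) ?_
    have hX' : algebraMap ℚ Fr X ≠ 0 := (map_ne_zero _).2 hX
    have ht' := congrArg (algebraMap ℚ Fr) ht
    rw [mk_eq, mk_eq] at h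
    simp only [map_sub, map_mul, map_pow, map_add, map_one, map_neg, map_ofNat] at ht' h
    have hd : algebraMap ℚ Fr t - s ≠ 0 := by
      intro h0
      have := congrArg im h0
      rw [algebraMap_eq] at this
      simp at this
    generalize algebraMap ℚ Fr t = T at *
    generalize algebraMap ℚ Fr X = Z at *
    generalize hRR : ε * W ^ 3 = R at *
    have e : 3 * ε * (-W / Z) ^ 3 = -3 * R / Z ^ 3 := by
      rw [← hRR, div_pow]
      ring
    rw [e, eq_div_iff (pow_ne_zero _ hX')]
    apply mul_right_cancel₀ (pow_ne_zero 2 hd)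
    have h' : R * (T - s) = T + s := by linear_combination -h
    have h1 : (R ^ 2 + R + 1) * (T - s) ^ 2 = 3 * (T ^ 2 + 1) := by
      linear_combination (R * (T - s) + (T + s) + (T - s)) * h' + s_sq
    have h2 : R * (T - s) ^ 2 = T ^ 2 - 3 := by
      linear_combination (T - s) * h' - s_sq
    linear_combination Z ^ 3 * h1 + 3 * h2 - 3 * ht'
  rw [hR] at h
  have := congrArg re h
  simp at this
  linarith

lemma eq_of_sq_eq {t X : ℚ} (hX : X ≠ 0) (ht : 3 - t ^ 2 = X ^ 3 * (1 + t ^ 2)) :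
    (X = -1 ∨ X = 2) ∨ t = 1 ∨ t = -1 := by
  obtain ⟨j, hj, W, h⟩ := exists_eq_pow_mul_cube t X ht
  interval_cases j
  · exact Or.inl (eq_neg_one_or_two_of_cube hX ht (by simpa using h))
  · exact Or.inr (Or.inl (eq_one_of_eq_ε_mul_cube hX ht (by simpa using h)))
  · refine Or.inr (Or.inr (neg_eq_iff_eq_neg.1 (eq_one_of_eq_ε_mul_cube (W := 1 / (ε * W)) hX
      (by rwa [neg_sq]) ?_)))
    have hε := ε_ne_zero
    have hW : W ≠ 0 := by
      rintro rfl
      have := congrArg im h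
      simp at this
    have e1 : (⟨-t, 1⟩ : Fr) = -⟨t, -1⟩ := by ext <;> simp
    have e2 : (⟨-t, -1⟩ : Fr) = -⟨t, 1⟩ := by ext <;> simp
    rw [e1, e2, h]
    field_simp

end RationalPointsC3

/-- The only affine rational points of the hyperelliptic curve
`C₃ : Y² = -X⁶ + 2X³ + 3` are `(-1, 0)`, `(1, 2)` and `(1, -2)`. -/
theorem rational_points_C3 (X Y : ℚ)
    (h : Y ^ 2 = -X ^ 6 + 2 * X ^ 3 + 3) :
    (X = -1 ∧ Y = 0) ∨ (X = 1 ∧ Y = 2) ∨ (X = 1 ∧ Y = -2) := by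
  have cube_inj : ∀ a b : ℚ, a ^ 3 = b ^ 3 → a = b := fun a b hab =>
    (Odd.strictMono_pow (by decide : Odd 3)).injective hab
  have hX : X ≠ 0 := by
    rintro rfl
    have h3 : IsSquare (3 : ℚ) := ⟨Y, by linarith⟩
    have h3' : IsSquare (3 : ℕ) := Rat.isSquare_natCast_iff.1 (by exact_mod_cast h3)
    exact Nat.prime_three.not_isSquare h3'
  by_cases h1 : X ^ 3 + 1 = 0
  · obtain rfl : X = -1 := cube_inj X (-1) (by linarith)
    refine Or.inl ⟨rfl, ?_⟩
    norm_num at h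
    exact h
  have ht : 3 - (Y / (X ^ 3 + 1)) ^ 2 = X ^ 3 * (1 + (Y / (X ^ 3 + 1)) ^ 2) := by
    rw [div_pow, h]
    field_simp
    ring
  rcases RationalPointsC3.eq_of_sq_eq hX ht with (rfl | rfl) | hY
  · norm_num at h1
  · nlinarith [sq_nonneg Y]
  · have hY2 : (Y / (X ^ 3 + 1)) ^ 2 = 1 := by
      rcases hY with hY | hY <;> rw [hY] <;> norm_num
    rw [hY2] at ht
    obtain rfl : X = 1 := cube_inj X 1 (by linarith)
    have : (Y - 2) * (Y + 2) = 0 := by linear_combination h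
    rcases mul_eq_zero.1 this with h2 | h2
    · exact Or.inr (Or.inl ⟨rfl, by linarith⟩)
    · exact Or.inr (Or.inr ⟨rfl, by linarith⟩)
end

section
/- There are no integers x, y, z with (x, y) ≠ (0, 0) satisfying 5x⁶ + 54x⁵y + 213x⁴y² + 360x³y³ + 384x²y⁴ + 216xy⁵ + 68y⁶ = z². (Equivalently, the hyperelliptic curve Y² = 5X⁶ + 54X⁵ + 213X⁴ + 360X³ + 384X² + 216X + 68 has no rational points.) -/
/-!
Write `ε = 1 + √2`, `ξ = x + y√2` and `p + q√2 = ε ξ³` in `ℤ[√2]`. The form equals `4p² + q²`,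
so when it is a square, the parametrisation of Pythagorean triples gives coprime `m`, `n` with
`p + q√2 = c (m + n√2)(m√2 - n)` and `c ∈ {1, 2}`. Unique factorisation in `ℤ[√2]` makes
`m + n√2` a unit times a cube. Modulo 5 this unit must be `ε²` up to cubes, and modulo 11 it
cannot be.
-/

namespace ZsqrtTwo

open Zsqrtd

theorem norm_eq_zero_iff (a : ℤ√2) : a.norm = 0 ↔ a = 0 := by
  refine Zsqrtd.norm_eq_zero (fun n h => ?_) a
  have h₁ : n < 2 := by nlinarith
  have h₂ : -2 < n := by nlinarith
  interval_cases n <;> omega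

/-- Quotient in `ℤ[√2]`, obtained by rounding the coordinates of the exact quotient. -/
def quot (x y : ℤ√2) : ℤ√2 :=
  ⟨round ((x * star y).re / y.norm : ℚ), round ((x * star y).im / y.norm : ℚ)⟩

theorem natAbs_norm_sub_mul_quot_lt (x : ℤ√2) {y : ℤ√2} (hy : y ≠ 0) :
    (x - y * quot x y).norm.natAbs < y.norm.natAbs := by
  have hN : (y.norm : ℚ) ≠ 0 := by exact_mod_cast mt (norm_eq_zero_iff y).1 hy
  set a : ℚ := (x * star y).re / y.norm with ha
  set b : ℚ := (x * star y).im / y.norm with hb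
  have hnorm : ((x - y * quot x y).norm : ℚ) =
      y.norm * ((a - round a) ^ 2 - 2 * (b - round b) ^ 2) := by
    have key : (x - y * quot x y).norm * y.norm =
        ((x * star y).re - y.norm * (quot x y).re) ^ 2
          - 2 * ((x * star y).im - y.norm * (quot x y).im) ^ 2 := by
      simp only [Zsqrtd.norm_def, Zsqrtd.re_sub, Zsqrtd.im_sub, Zsqrtd.re_mul, Zsqrtd.im_mul,
        Zsqrtd.re_star, Zsqrtd.im_star]
      ring
    have hre : ((x * star y).re : ℚ) = y.norm * a := by rw [ha]; field_simp
    have him : ((x * star y).im : ℚ) = y.norm * b := by rw [hb]; field_simp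
    have key' := congrArg (Int.cast : ℤ → ℚ) key
    have hq₁ : (quot x y).re = round a := rfl
    have hq₂ : (quot x y).im = round b := rfl
    rw [hq₁, hq₂] at key'
    simp only [Int.cast_mul, Int.cast_sub, Int.cast_pow, Int.cast_ofNat, hre, him] at key'
    apply mul_right_cancel₀ hN
    rw [key']
    ring
  have h₁ := abs_le.1 (abs_sub_round a)
  have h₂ := abs_le.1 (abs_sub_round b)
  have hlt : |(a - round a) ^ 2 - 2 * (b - round b) ^ 2| < 1 := by
    rw [abs_lt]
    constructor <;> nlinarith [sq_nonneg (a - round a), sq_nonneg (b - round b)]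
  zify
  have : |((x - y * quot x y).norm : ℚ)| < |(y.norm : ℚ)| := by
    rw [hnorm, abs_mul]
    exact mul_lt_of_lt_one_right (abs_pos.2 hN) hlt
  exact_mod_cast this

instance : EuclideanDomain (ℤ√2) :=
  { Zsqrtd.commRing, Zsqrtd.nontrivial with
    quotient := quot
    remainder := fun x y => x - y * quot x y
    quotient_zero := fun x => by simp [quot, Zsqrtd.ext_iff]
    quotient_mul_add_remainder_eq := fun x y => by simp
    r := _
    r_wellFounded := (measure (Int.natAbs ∘ Zsqrtd.norm)).wf
    remainder_lt := natAbs_norm_sub_mul_quot_lt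
    mul_left_not_lt := fun a b hb => by
      refine not_lt_of_ge (show a.norm.natAbs ≤ (a * b).norm.natAbs from ?_)
      rw [Zsqrtd.norm_mul, Int.natAbs_mul]
      exact Nat.le_mul_of_pos_right _ (Int.natAbs_pos.2 (mt (norm_eq_zero_iff b).1 hb)) }

/-- The fundamental unit `1 + √2`. -/
def eps : ℤ√2 := ⟨1, 1⟩

theorem eps_mul_inv : eps * ⟨-1, 1⟩ = 1 := by decide

/-- The solution `3 + 2√2` of the Pell equation `x² - 2y² = 1`. -/
def pellUnit : Pell.Solution₁ 2 := Pell.Solution₁.mk 3 2 (by norm_num)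

theorem isFundamental_pellUnit : Pell.IsFundamental pellUnit := by
  refine ⟨by simp [pellUnit], by simp [pellUnit], fun {b} hb => ?_⟩
  have h := b.prop
  by_contra! hlt
  have h₂ : b.x = 2 := by
    simp only [pellUnit, Pell.Solution₁.x_mk] at hlt
    omega
  rw [h₂] at h
  omega

theorem exists_eps_pow_mul_cube_of_norm_eq_one {u : ℤ√2} (hu : u.norm = 1) :
    ∃ i < 3, ∃ v, u = eps ^ i * v ^ 3 := by
  obtain ⟨k, hk⟩ := isFundamental_pellUnit.eq_zpow_or_neg_zpow
    ⟨u, Zsqrtd.norm_eq_one_iff_mem_unitary.1 hu⟩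
  obtain ⟨w, t, ht, hw⟩ : ∃ (w : Pell.Solution₁ 2) (t : ℕ), t < 3 ∧
      pellUnit ^ k = pellUnit ^ t * w ^ 3 := by
    refine ⟨pellUnit ^ (k / 3), (k % 3).toNat, by omega, ?_⟩
    rw [← zpow_natCast, ← zpow_natCast, ← zpow_mul, ← zpow_add]
    congr 1
    push_cast
    omega
  obtain ⟨s, hs⟩ : ∃ s : ℤ√2, u = (pellUnit : ℤ√2) ^ t * s ^ 3 := by
    rcases hk with hk | hk
    · refine ⟨w, ?_⟩
      exact congrArg Subtype.val (hk.trans hw)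
    · refine ⟨-w, ?_⟩
      have : u = -((pellUnit : ℤ√2) ^ t * (w : ℤ√2) ^ 3) :=
        congrArg Subtype.val (hk.trans (congrArg Neg.neg hw))
      rw [this]
      ring
  have hp : (pellUnit : ℤ√2) = eps ^ 2 := by decide
  rw [hp] at hs
  interval_cases t
  · exact ⟨0, by norm_num, s, by rw [hs]; ring⟩
  · exact ⟨2, by norm_num, s, by rw [hs]; ring⟩
  · exact ⟨1, by norm_num, eps * s, by rw [hs]; ring⟩

theorem exists_eps_pow_mul_cube_of_isUnit {u : ℤ√2} (hu : IsUnit u) :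
    ∃ i < 3, ∃ v, u = eps ^ i * v ^ 3 := by
  rcases Int.isUnit_iff.1 ((Zsqrtd.isUnit_iff_norm_isUnit u).1 hu) with h | h
  · exact exists_eps_pow_mul_cube_of_norm_eq_one h
  · have h' : (eps * u).norm = 1 := by
      rw [Zsqrtd.norm_mul, h]
      decide
    obtain ⟨i, hi, v, hv⟩ := exists_eps_pow_mul_cube_of_norm_eq_one h'
    have hu' : u = ⟨-1, 1⟩ * (eps ^ i * v ^ 3) := by
      rw [← hv, ← mul_assoc, mul_comm _ eps, eps_mul_inv, one_mul]
    have hinv := eps_mul_inv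
    set δ : ℤ√2 := ⟨-1, 1⟩
    interval_cases i
    · exact ⟨2, by norm_num, δ * v, by
        rw [hu']; linear_combination (-δ * v ^ 3 * (eps * δ + 1)) * hinv⟩
    · exact ⟨0, by norm_num, v, by rw [hu']; linear_combination v ^ 3 * hinv⟩
    · exact ⟨1, by norm_num, v, by rw [hu']; linear_combination eps * v ^ 3 * hinv⟩

theorem exists_eq_eps_pow_mul_cube {a b c : ℤ√2} (hab : IsCoprime a b)
    (h : a * b = eps * c ^ 3) : ∃ i < 3, ∃ v, a = eps ^ i * v ^ 3 := by
  have hinv := eps_mul_inv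
  set δ : ℤ√2 := ⟨-1, 1⟩
  have hδ : IsUnit δ := IsUnit.of_mul_eq_one eps (by rw [mul_comm, hinv])
  obtain ⟨d, u, hu⟩ := exists_associated_pow_of_mul_eq_pow'
    ((isCoprime_mul_unit_left_right hδ a b).2 hab)
    (show a * (δ * b) = c ^ 3 by linear_combination δ * h + c ^ 3 * hinv)
  obtain ⟨i, hi, v, hv⟩ := exists_eps_pow_mul_cube_of_isUnit u.isUnit
  exact ⟨i, hi, v * d, by rw [← hu, hv]; ring⟩

theorem not_isCoprime_of_intCast_eq_zero {p : ℕ} (hp : p ≠ 1) {m n : ℤ}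
    (h : (m : ZMod p) = 0 ∧ (n : ZMod p) = 0) : ¬IsCoprime m n := fun hmn => by
  have := hmn.isUnit_of_dvd' ((ZMod.intCast_zmod_eq_zero_iff_dvd m p).1 h.1)
    ((ZMod.intCast_zmod_eq_zero_iff_dvd n p).1 h.2)
  exact hp (by simpa [Int.isUnit_iff_natAbs_eq] using this)

theorem isCoprime_of_odd {m n c : ℤ} (hmn : IsCoprime m n) (hm : Odd m) (hc : c = 1 ∨ c = 2) :
    IsCoprime (⟨m, n⟩ : ℤ√2) (c * ⟨-n, m⟩) := by
  have hN : IsCoprime (m ^ 2 - 2 * n ^ 2) (6 : ℤ) := by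
    have h₂ : IsCoprime (m ^ 2 - 2 * n ^ 2) (2 : ℤ) := by
      obtain ⟨k, rfl⟩ := hm
      exact ⟨1, -(2 * k ^ 2 + 2 * k - n ^ 2), by ring⟩
    have h₃ : IsCoprime (m ^ 2 - 2 * n ^ 2) (3 : ℤ) := by
      rw [isCoprime_comm, Prime.coprime_iff_not_dvd Int.prime_three]
      intro h
      have h' := (ZMod.intCast_zmod_eq_zero_iff_dvd _ 3).2 (by exact_mod_cast h)
      push_cast at h'
      have key : ∀ a b : ZMod 3, a ^ 2 - 2 * b ^ 2 = 0 → a = 0 ∧ b = 0 := by decide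
      exact not_isCoprime_of_intCast_eq_zero (by norm_num) (key _ _ h') hmn
    simpa using h₂.mul_right h₃
  have h₆ : IsCoprime (⟨m, n⟩ : ℤ√2) ((2 : ℤ) * (3 : ℤ)) := by
    have := (hN.map (Int.castRingHom (ℤ√2))).of_isCoprime_of_dvd_left
      (x := (⟨m, n⟩ : ℤ√2)) ⟨⟨m, -n⟩, by
        ext <;> simp [pow_two] <;> ring⟩
    rw [← Int.cast_mul]
    exact this
  have hc' : IsCoprime (⟨m, n⟩ : ℤ√2) c := by
    rcases hc with rfl | rfl
    · simpa using isCoprime_one_right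
    · exact h₆.of_mul_right_left
  refine hc'.mul_right ?_
  have hn : IsCoprime (⟨m, n⟩ : ℤ√2) (n : ℤ) := by
    have := (hmn.map (Int.castRingHom (ℤ√2))).add_mul_left_left (sqrtd : ℤ√2)
    have heq : (⟨m, n⟩ : ℤ√2) = Int.castRingHom (ℤ√2) m + Int.castRingHom (ℤ√2) n * sqrtd := by
      ext <;> simp
    rwa [← heq] at this
  have := (h₆.of_mul_right_right.mul_right hn).neg_right.add_mul_left_right (sqrtd : ℤ√2)
  have heq : (⟨-n, m⟩ : ℤ√2) = -(((3 : ℤ) : ℤ√2) * (n : ℤ√2)) + ⟨m, n⟩ * sqrtd := by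
    ext <;> simp
    ring
  rwa [← heq] at this

/-- In `ZMod 5`, the coordinates of a cube `(r + s√2)³` have product zero. -/
theorem cube_zmod_five : ∀ r s : ZMod 5,
    (r ^ 3 + 6 * r * s ^ 2) * (3 * r ^ 2 * s + 2 * s ^ 3) = 0 := by
  decide +kernel

/-- In `ZMod 11`, the fourth power of a cube `(r + s√2)³` has vanishing `√2`-coordinate. -/
theorem cube_zmod_eleven : ∀ r s : ZMod 11,
    (r ^ 3 + 6 * r * s ^ 2) * (3 * r ^ 2 * s + 2 * s ^ 3) *
      ((r ^ 3 + 6 * r * s ^ 2) ^ 2 + 2 * (3 * r ^ 2 * s + 2 * s ^ 3) ^ 2) = 0 := by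
  decide +kernel

theorem zmod_five_sieve : ∀ c m n : ZMod 5, c = 1 ∨ c = 2 →
    (2 * (c * (m ^ 2 - n ^ 2)) - c * (m * n)) * (c * (m * n) - c * (m ^ 2 - n ^ 2)) = 0 →
    m * n = 0 ∨ (2 * n - m) * (m - n) = 0 → m = 0 ∧ n = 0 := by
  decide +kernel

theorem zmod_eleven_sieve : ∀ c m n : ZMod 11, c = 1 ∨ c = 2 →
    (2 * (c * (m ^ 2 - n ^ 2)) - c * (m * n)) * (c * (m * n) - c * (m ^ 2 - n ^ 2)) *
      ((2 * (c * (m ^ 2 - n ^ 2)) - c * (m * n)) ^ 2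
        + 2 * (c * (m * n) - c * (m ^ 2 - n ^ 2)) ^ 2) = 0 →
    (3 * m - 4 * n) * (3 * n - 2 * m) * ((3 * m - 4 * n) ^ 2 + 2 * (3 * n - 2 * m) ^ 2) = 0 →
    m = 0 ∧ n = 0 := by
  decide +kernel

theorem no_solution_of_odd {m n c x y : ℤ} (hmn : IsCoprime m n) (hm : Odd m)
    (hc : c = 1 ∨ c = 2)
    (hp : c * (m * n) = x ^ 3 + 6 * x ^ 2 * y + 6 * x * y ^ 2 + 4 * y ^ 3)
    (hq : c * (m ^ 2 - n ^ 2) = x ^ 3 + 3 * x ^ 2 * y + 6 * x * y ^ 2 + 2 * y ^ 3) : False := by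
  have h : (⟨m, n⟩ : ℤ√2) * (c * ⟨-n, m⟩) = eps * ⟨x, y⟩ ^ 3 := by
    ext
    · simp [eps, pow_succ]
      linear_combination hp
    · simp [eps, pow_succ]
      linear_combination hq
  obtain ⟨i, hi, ⟨r, s⟩, hv⟩ := exists_eq_eps_pow_mul_cube (isCoprime_of_odd hmn hm hc) h
  have hre := congrArg Zsqrtd.re hv
  have him := congrArg Zsqrtd.im hv
  have hcp (p : ℕ) : (c : ZMod p) = 1 ∨ (c : ZMod p) = 2 := by
    rcases hc with rfl | rfl <;> simp
  have hX : 2 * (c * (m ^ 2 - n ^ 2)) - c * (m * n) = x ^ 3 + 6 * x * y ^ 2 := by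
    linear_combination 2 * hq - hp
  have hY : c * (m * n) - c * (m ^ 2 - n ^ 2) = 3 * x ^ 2 * y + 2 * y ^ 3 := by
    linear_combination hp - hq
  have hXp (p : ℕ) := congrArg (Int.cast : ℤ → ZMod p) hX
  have hYp (p : ℕ) := congrArg (Int.cast : ℤ → ZMod p) hY
  push_cast at hXp hYp
  have h₅ := zmod_five_sieve c m n (hcp 5) (by rw [hXp, hYp, cube_zmod_five])
  have h₁₁ := zmod_eleven_sieve c m n (hcp 11) (by rw [hXp, hYp, cube_zmod_eleven])
  interval_cases i
  · have hA : m = r ^ 3 + 6 * r * s ^ 2 := by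
      simp [pow_succ] at hre
      linear_combination hre
    have hB : n = 3 * r ^ 2 * s + 2 * s ^ 3 := by
      simp [pow_succ] at him
      linear_combination him
    refine not_isCoprime_of_intCast_eq_zero (by norm_num) (h₅ (Or.inl ?_)) hmn
    rw [hA, hB]
    push_cast
    exact cube_zmod_five r s
  · have hA : 2 * n - m = r ^ 3 + 6 * r * s ^ 2 := by
      simp [eps, pow_succ] at hre him
      linear_combination 2 * him - hre
    have hB : m - n = 3 * r ^ 2 * s + 2 * s ^ 3 := by
      simp [eps, pow_succ] at hre him
      linear_combination hre - him
    have hA' := congrArg (Int.cast : ℤ → ZMod 5) hA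
    have hB' := congrArg (Int.cast : ℤ → ZMod 5) hB
    push_cast at hA' hB'
    exact not_isCoprime_of_intCast_eq_zero (by norm_num)
      (h₅ (Or.inr (by rw [hA', hB', cube_zmod_five]))) hmn
  · have hA : 3 * m - 4 * n = r ^ 3 + 6 * r * s ^ 2 := by
      simp [eps, pow_succ] at hre him
      linear_combination 3 * hre - 4 * him
    have hB : 3 * n - 2 * m = 3 * r ^ 2 * s + 2 * s ^ 3 := by
      simp [eps, pow_succ] at hre him
      linear_combination 3 * him - 2 * hre
    have hA' := congrArg (Int.cast : ℤ → ZMod 11) hA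
    have hB' := congrArg (Int.cast : ℤ → ZMod 11) hB
    push_cast at hA' hB'
    exact not_isCoprime_of_intCast_eq_zero (by norm_num)
      (h₁₁ (by rw [hA', hB', cube_zmod_eleven])) hmn

theorem no_solution {m n c x y : ℤ} (hmn : IsCoprime m n) (hodd : Odd m ∨ Odd n)
    (hc : c = 1 ∨ c = 2)
    (hp : c * (m * n) = x ^ 3 + 6 * x ^ 2 * y + 6 * x * y ^ 2 + 4 * y ^ 3)
    (hq : c * (m ^ 2 - n ^ 2) = x ^ 3 + 3 * x ^ 2 * y + 6 * x * y ^ 2 + 2 * y ^ 3) : False := by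
  rcases hodd with hm | hn
  · exact no_solution_of_odd hmn hm hc hp hq
  · exact no_solution_of_odd (x := -x) (y := -y) hmn.symm.neg_right hn hc
      (by linear_combination -hp) (by linear_combination -hq)

theorem isCoprime_coords {x y q : ℤ} (hxy : IsCoprime x y)
    (hq : x ^ 3 + 3 * x ^ 2 * y + 6 * x * y ^ 2 + 2 * y ^ 3 = 2 * q) :
    IsCoprime (x ^ 3 + 6 * x ^ 2 * y + 6 * x * y ^ 2 + 4 * y ^ 3) q := by
  have not_two_dvd (h₁ : 2 ∣ x ^ 3 + 6 * x ^ 2 * y + 6 * x * y ^ 2 + 4 * y ^ 3)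
      (h₂ : 2 ∣ q) : False := by
    have hx : (2 : ℤ) ∣ x := Int.prime_two.dvd_of_dvd_pow (n := 3) <| by
      obtain ⟨k, hk⟩ := h₁
      exact ⟨k - 3 * x ^ 2 * y - 3 * x * y ^ 2 - 2 * y ^ 3, by linear_combination hk⟩
    obtain ⟨a, rfl⟩ := hx
    have hy : (2 : ℤ) ∣ y := Int.prime_two.dvd_of_dvd_pow (n := 3) <| by
      obtain ⟨k, rfl⟩ := h₂
      exact ⟨k - 2 * a ^ 3 - 3 * a ^ 2 * y - 3 * a * y ^ 2, by linarith⟩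
    exact Int.prime_two.not_isUnit (hxy.isUnit_of_dvd' (dvd_mul_right 2 a) hy)
  have of_prime (l : ℤ) (hl : Prime l)
      (h₁ : l ∣ x ^ 3 + 6 * x ^ 2 * y + 6 * x * y ^ 2 + 4 * y ^ 3) (h₂ : l ∣ q) : False := by
    have h₃ : ¬l ∣ 2 := fun h => by
      have h' := ((hl.dvd_prime_iff_associated Int.prime_two).1 h).symm.dvd
      exact not_two_dvd (h'.trans h₁) (h'.trans h₂)
    have hX : l ∣ x ^ 3 + 6 * x * y ^ 2 := by
      have := dvd_sub (h₂.mul_left 4) h₁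
      rwa [show 4 * q - _ = x ^ 3 + 6 * x * y ^ 2 by linear_combination -2 * hq] at this
    have hY : l ∣ 3 * x ^ 2 * y + 2 * y ^ 3 := by
      have := dvd_sub h₁ (h₂.mul_left 2)
      rwa [show _ - 2 * q = 3 * x ^ 2 * y + 2 * y ^ 3 by linear_combination hq] at this
    have h : l ∣ 2 ^ 3 * (x ^ 3 * y) := by
      have := dvd_sub (hY.mul_left (3 * x)) (hX.mul_left y)
      rwa [show _ - y * _ = 2 ^ 3 * (x ^ 3 * y) by ring] at this
    rcases hl.dvd_or_dvd h with h | h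
    · exact h₃ (hl.dvd_of_dvd_pow h)
    rcases hl.dvd_or_dvd h with h | hy
    · have hx := hl.dvd_of_dvd_pow h
      have : l ∣ 2 * y ^ 3 := by
        have := dvd_sub hY (hx.mul_left (3 * x * y))
        rwa [show _ - 3 * x * y * x = 2 * y ^ 3 by ring] at this
      rcases hl.dvd_or_dvd this with h | h
      · exact h₃ h
      · exact hl.not_isUnit (hxy.isUnit_of_dvd' hx (hl.dvd_of_dvd_pow h))
    · have : l ∣ x ^ 3 := by
        have := dvd_sub hX (hy.mul_left (6 * x * y))
        rwa [show _ - 6 * x * y * y = x ^ 3 by ring] at this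
      exact hl.not_isUnit (hxy.isUnit_of_dvd' (hl.dvd_of_dvd_pow this) hy)
  refine isCoprime_of_prime_dvd (fun h => ?_) of_prime
  exact not_two_dvd (h.1 ▸ dvd_zero 2) (h.2 ▸ dvd_zero 2)

theorem exists_half_of_sq {x y z : ℤ}
    (h : 4 * (x ^ 3 + 6 * x ^ 2 * y + 6 * x * y ^ 2 + 4 * y ^ 3) ^ 2
      + (x ^ 3 + 3 * x ^ 2 * y + 6 * x * y ^ 2 + 2 * y ^ 3) ^ 2 = z ^ 2) :
    ∃ q w, x ^ 3 + 3 * x ^ 2 * y + 6 * x * y ^ 2 + 2 * y ^ 3 = 2 * q ∧ z = 2 * w := by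
  have key : ∀ a b c : ZMod 8, 4 * (a ^ 3 + 6 * a ^ 2 * b + 6 * a * b ^ 2 + 4 * b ^ 3) ^ 2
      + (a ^ 3 + 3 * a ^ 2 * b + 6 * a * b ^ 2 + 2 * b ^ 3) ^ 2 = c ^ 2 →
      4 * (a ^ 3 + 3 * a ^ 2 * b + 6 * a * b ^ 2 + 2 * b ^ 3) = 0 ∧ 4 * c = 0 := by
    decide +kernel
  have h' := key x y z (by exact_mod_cast congrArg (Int.cast : ℤ → ZMod 8) h)
  have h₁ := (ZMod.intCast_zmod_eq_zero_iff_dvd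
    (4 * (x ^ 3 + 3 * x ^ 2 * y + 6 * x * y ^ 2 + 2 * y ^ 3)) 8).1 (by exact_mod_cast h'.1)
  have h₂ := (ZMod.intCast_zmod_eq_zero_iff_dvd (4 * z) 8).1 (by exact_mod_cast h'.2)
  obtain ⟨q, hq⟩ := h₁
  obtain ⟨w, hw⟩ := h₂
  push_cast at hq hw
  exact ⟨q, w, by linarith, by linarith⟩

theorem ne_sq_of_isCoprime {x y z : ℤ} (hxy : IsCoprime x y) :
    5 * x ^ 6 + 54 * x ^ 5 * y + 213 * x ^ 4 * y ^ 2 + 360 * x ^ 3 * y ^ 3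
      + 384 * x ^ 2 * y ^ 4 + 216 * x * y ^ 5 + 68 * y ^ 6 ≠ z ^ 2 := by
  intro h
  obtain ⟨q, w, hq, rfl⟩ := exists_half_of_sq (x := x) (y := y) (z := z)
    (by linear_combination h)
  have hcop := isCoprime_coords hxy hq
  set p := x ^ 3 + 6 * x ^ 2 * y + 6 * x * y ^ 2 + 4 * y ^ 3 with hp
  have hpyth : PythagoreanTriple p q w := by
    have : 4 * (p * p + q * q) = 4 * (w * w) := by
      rw [hp]
      linear_combination h -
        (x ^ 3 + 3 * x ^ 2 * y + 6 * x * y ^ 2 + 2 * y ^ 3 + 2 * q) * hq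
    exact mul_left_cancel₀ (by norm_num) this
  obtain ⟨m, n, hpq, -, hmn, hpar⟩ := PythagoreanTriple.coprime_classification.1
    ⟨hpyth, Int.isCoprime_iff_gcd_eq_one.1 hcop⟩
  have hmn' := Int.isCoprime_iff_gcd_eq_one.2 hmn
  have hodd : Odd (m + n) := Int.odd_iff.2 (by omega)
  rcases hpq with ⟨h₁, h₂⟩ | ⟨h₁, h₂⟩
  · have h2 : IsCoprime (m + n) 2 := by
      obtain ⟨k, hk⟩ := hodd
      exact ⟨1, -k, by linear_combination hk⟩
    have hm : IsCoprime (m + n) m := by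
      simpa [add_comm] using hmn'.symm.add_mul_left_left 1
    have hsum : IsCoprime (m + n) (m - n) := by
      have := (h2.mul_right hm).add_mul_left_right (-1)
      rwa [show 2 * m + (m + n) * -1 = m - n by ring] at this
    exact no_solution (x := x) (y := y) (c := 1) hsum (Or.inl hodd) (Or.inl rfl)
      (by linear_combination hp - h₁) (by linear_combination -2 * h₂ - hq)
  · refine no_solution (x := x) (y := y) (c := 2) hmn' ?_ (Or.inr rfl)
      (by linear_combination hp - h₁) (by linear_combination -2 * h₂ - hq)
    rw [Int.odd_iff, Int.odd_iff]
    omega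

end ZsqrtTwo

/-- The binary sextic form `5x⁶ + 54x⁵y + 213x⁴y² + 360x³y³ + 384x²y⁴ + 216xy⁵ + 68y⁶`
is never a perfect square at integers `(x, y) ≠ (0, 0)`; equivalently, the genus-two
curve `Y² = 5X⁶ + 54X⁵ + 213X⁴ + 360X³ + 384X² + 216X + 68` has no rational points. -/
theorem no_square_values_sextic (x y z : ℤ) (hxy : ¬(x = 0 ∧ y = 0)) :
    5 * x ^ 6 + 54 * x ^ 5 * y + 213 * x ^ 4 * y ^ 2 + 360 * x ^ 3 * y ^ 3
      + 384 * x ^ 2 * y ^ 4 + 216 * x * y ^ 5 + 68 * y ^ 6 ≠ z ^ 2 := by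
  intro h
  have hpos : 0 < Int.gcd x y := Nat.pos_of_ne_zero (mt Int.gcd_eq_zero_iff.1 hxy)
  obtain ⟨a, b, hab, hx, hy⟩ := Int.exists_gcd_one hpos
  have hg : (Int.gcd x y : ℤ) ≠ 0 := by exact_mod_cast hpos.ne'
  generalize (Int.gcd x y : ℤ) = g at hx hy hg
  subst hx hy
  have hdvd : g ^ 3 ∣ z := by
    rw [← Int.pow_dvd_pow_iff two_ne_zero, ← h]
    exact ⟨5 * a ^ 6 + 54 * a ^ 5 * b + 213 * a ^ 4 * b ^ 2 + 360 * a ^ 3 * b ^ 3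
      + 384 * a ^ 2 * b ^ 4 + 216 * a * b ^ 5 + 68 * b ^ 6, by ring⟩
  obtain ⟨w, rfl⟩ := hdvd
  refine ZsqrtTwo.ne_sq_of_isCoprime (Int.isCoprime_iff_gcd_eq_one.2 hab) (z := w) ?_
  apply mul_left_cancel₀ (pow_ne_zero 6 hg)
  linear_combination h
end
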